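/- arXiv:2303.16785 — 3 statements merged into one kernel-verified Lean document; each statement's English description precedes it below -/
import Mathlib

section
/- For every $z \in \mathbb{C}^n$ such that $\langle w_{v,i}, z\rangle \ne 0$ for all vertices $v$ of $P$ and all $i = 1,\dots,n$, one has the vertex localization formula $\int_P e^{\langle m, z\rangle}\, d\lambda(m) \;=\; \sum_{v \text{ vertex of } P} |\det(w_{v,1},\dots,w_{v,n})|\; e^{\langle v, z\rangle} \prod_{i=1}^n \frac{-1}{\langle w_{v,i}, z\rangle}$. -/
open MeasureTheory Classical

noncomputable section

/-- Cast a lattice vector to a real vector. -/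
def castZ {n : ℕ} (x : Fin n → ℤ) : Fin n → ℝ := fun i => (x i : ℝ)

/-- The standard `ℂ`-bilinear pairing between `ℝ^n` and `ℂ^n`. -/
def pairC {n : ℕ} (m : Fin n → ℝ) (z : Fin n → ℂ) : ℂ := ∑ j, (m j : ℂ) * z j

/-- The (shifted) simplicial cone with apex `v` spanned by the lattice vectors `w i`. -/
def tanCone {n : ℕ} (v : Fin n → ℝ) (w : Fin n → Fin n → ℤ) : Set (Fin n → ℝ) :=
  {x | ∃ a : Fin n → ℝ, (∀ i, 0 ≤ a i) ∧ x = v + ∑ i, a i • castZ (w i)}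

open Set Filter Topology
open scoped ContDiff Manifold

/-- The iterated directional derivative of `f` along the vectors of a list. -/
def dirDeriv {E : Type*} [NormedAddCommGroup E] [NormedSpace ℝ E] :
    List E → (E → ℂ) → E → ℂ
  | [], f => f
  | w :: L, f => fun x => fderiv ℝ (dirDeriv L f) x w

section dirDeriv

variable {E E' : Type*} [NormedAddCommGroup E] [NormedSpace ℝ E]
  [NormedAddCommGroup E'] [NormedSpace ℝ E']

lemma ContDiff.fderiv_apply_const {f : E → ℂ} (hf : ContDiff ℝ ∞ f) (w : E) :
    ContDiff ℝ ∞ fun x => fderiv ℝ f x w :=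
  (hf.fderiv_right (m := ∞) (by simp)).clm_apply contDiff_const

lemma ContDiff.dirDeriv {f : E → ℂ} (hf : ContDiff ℝ ∞ f) (L : List E) :
    ContDiff ℝ ∞ (dirDeriv L f) := by
  induction L with
  | nil => exact hf
  | cons w L ih => exact ih.fderiv_apply_const w

lemma tsupport_dirDeriv_subset (f : E → ℂ) (L : List E) :
    tsupport (dirDeriv L f) ⊆ tsupport f := by
  induction L with
  | nil => exact subset_rfl
  | cons w L ih => exact (tsupport_fderiv_apply_subset ℝ w).trans ih

lemma HasCompactSupport.dirDeriv {f : E → ℂ} (hf : HasCompactSupport f) (L : List E) :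
    HasCompactSupport (dirDeriv L f) :=
  hf.of_isClosed_subset (isClosed_tsupport _) (tsupport_dirDeriv_subset f L)

lemma dirDeriv_append (L L' : List E) (f : E → ℂ) :
    dirDeriv (L ++ L') f = dirDeriv L (dirDeriv L' f) := by
  induction L with
  | nil => rfl
  | cons w L ih => simp [dirDeriv, ih]

lemma dirDeriv_perm {f : E → ℂ} (hf : ContDiff ℝ ∞ f) {L L' : List E} (h : L.Perm L') :
    dirDeriv L f = dirDeriv L' f := by
  induction h with
  | nil => rfl
  | cons w _ ih => simp [dirDeriv, ih]
  | swap a b L =>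
    funext x
    have hg : ContDiff ℝ ∞ (dirDeriv L f) := hf.dirDeriv L
    have hd : DifferentiableAt ℝ (fderiv ℝ (dirDeriv L f)) x :=
      (hg.fderiv_right (m := ∞) (by simp)).differentiable (by simp) x
    have hs : IsSymmSndFDerivAt ℝ (dirDeriv L f) x :=
      hg.contDiffAt.isSymmSndFDerivAt (by
        rw [minSmoothness_of_isRCLikeNormedField]; exact WithTop.coe_le_coe.2 le_top)
    simp only [dirDeriv]
    rw [fderiv_clm_apply hd (differentiableAt_const _),
      fderiv_clm_apply hd (differentiableAt_const _)]
    simpa using hs b a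
  | trans _ _ ih₁ ih₂ => exact ih₁.trans ih₂

lemma Filter.EventuallyEq.dirDeriv {f g : E → ℂ} {x : E} (h : f =ᶠ[𝓝 x] g) (L : List E) :
    dirDeriv L f =ᶠ[𝓝 x] dirDeriv L g := by
  induction L with
  | nil => exact h
  | cons w L ih => exact ih.fderiv.fun_comp fun T => T w

lemma dirDeriv_sum {ι : Type*} (s : Finset ι) {f : ι → E → ℂ}
    (hf : ∀ i ∈ s, ContDiff ℝ ∞ (f i)) (L : List E) :
    dirDeriv L (fun x => ∑ i ∈ s, f i x) = fun x => ∑ i ∈ s, dirDeriv L (f i) x := by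
  induction L with
  | nil => rfl
  | cons w L ih =>
    funext x
    simp only [dirDeriv, ih]
    rw [fderiv_fun_sum fun i hi => ((hf i hi).dirDeriv L).differentiable (by simp) x]
    simp

lemma dirDeriv_comp_affine (A : E' →L[ℝ] E) (v : E) {f : E → ℂ} (hf : ContDiff ℝ ∞ f)
    (L : List E') :
    dirDeriv L (fun x => f (v + A x)) = fun x => dirDeriv (L.map A) f (v + A x) := by
  induction L with
  | nil => rfl
  | cons w L ih =>
    funext x
    simp only [dirDeriv, ih, List.map_cons]
    have h1 : HasFDerivAt (fun x => v + A x) A x := A.hasFDerivAt.const_add v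
    have h2 := ((hf.dirDeriv (L.map A)).differentiable (by simp) (v + A x)).hasFDerivAt
    exact congrArg (fun T => T w) (h2.comp x h1).fderiv

lemma dirDeriv_cexp (ℓ : E →L[ℝ] ℂ) (L : List E) :
    dirDeriv L (fun x => Complex.exp (ℓ x)) =
      fun x => (L.map ℓ).prod * Complex.exp (ℓ x) := by
  induction L with
  | nil => simp [dirDeriv]
  | cons w L ih =>
    funext x
    simp only [dirDeriv, ih, List.map_cons, List.prod_cons]
    rw [((ℓ.hasFDerivAt (x := x)).cexp.const_mul (L.map ℓ).prod).fderiv]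
    simp
    ring

end dirDeriv

lemma integral_Ici_dirDeriv_single (n : ℕ) {f : (Fin n → ℝ) → ℂ} (hf : ContDiff ℝ ∞ f)
    (hc : HasCompactSupport f) :
    ∫ x in Ici (0 : Fin n → ℝ), dirDeriv (List.ofFn fun i => Pi.single i 1) f x =
      (-1) ^ n * f 0 := by
  induction n with
  | zero =>
    have : Ici (0 : Fin 0 → ℝ) = univ := eq_univ_of_forall fun x => by simp [Subsingleton.elim x 0]
    rw [this, Measure.restrict_univ, integral_unique]
    simp only [List.ofFn_zero, dirDeriv, pow_zero, one_mul]
    rw [show volume.real (univ : Set (Fin 0 → ℝ)) = 1 by simp [Measure.real, volume_pi], one_smul]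
    exact congrArg f (Subsingleton.elim _ _)
  | succ n ih =>
    let L : List (Fin (n + 1) → ℝ) := List.ofFn fun i : Fin n => Pi.single i.succ 1
    let H := dirDeriv L f
    have hH : ContDiff ℝ ∞ H := hf.dirDeriv L
    have hHc : HasCompactSupport H := hc.dirDeriv L
    let A : (Fin n → ℝ) →L[ℝ] (Fin (n + 1) → ℝ) :=
      ContinuousLinearMap.pi (Fin.cons 0 fun i => ContinuousLinearMap.proj i)
    have hA : ∀ y, A y = Fin.cons 0 y := fun y => by
      ext i; refine Fin.cases ?_ (fun i => ?_) i <;> simp [A]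
    have hAcl : Topology.IsClosedEmbedding A := by
      refine LinearMap.isClosedEmbedding_of_injective (f := A.toLinearMap) ?_
      refine LinearMap.ker_eq_bot.2 fun x y h => ?_
      simpa [hA] using h
    have hL : L = (List.ofFn fun i : Fin n => (Pi.single i 1 : Fin n → ℝ)).map A := by
      simp only [L, List.map_ofFn]
      congr 1; funext i
      ext j; refine Fin.cases ?_ (fun j => ?_) j <;> simp [hA, Pi.single_apply]
    have hslice : ∀ y : Fin n → ℝ,
        ∫ t in Ici (0 : ℝ), fderiv ℝ H (Fin.cons t y) (Pi.single 0 1) = - H (A y) := by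
      intro y
      have hd : ∀ t : ℝ, HasDerivAt (fun t : ℝ => (Fin.cons t y : Fin (n + 1) → ℝ))
          (Pi.single 0 1) t := by
        intro t
        rw [hasDerivAt_pi]
        intro i; refine Fin.cases ?_ (fun i => ?_) i
        · simpa using hasDerivAt_id' t
        · simpa using hasDerivAt_const t (y i)
      have hcd : ContDiff ℝ 1 fun t : ℝ => (Fin.cons t y : Fin (n + 1) → ℝ) := by
        rw [contDiff_pi]
        intro i; refine Fin.cases ?_ (fun i => ?_) i
        · simpa using contDiff_fun_id
        · simpa using contDiff_const
      have hcl : Topology.IsClosedEmbedding fun t : ℝ => (Fin.cons t y : Fin (n + 1) → ℝ) := by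
        refine Function.LeftInverse.isClosedEmbedding (f := fun x : Fin (n + 1) → ℝ => x 0) ?_
          (continuous_apply 0) hcd.continuous
        intro t; simp
      have := HasCompactSupport.integral_Ioi_deriv_eq
        (f := fun t : ℝ => H (Fin.cons t y)) ((hH.of_le (by simp)).comp hcd)
        (hHc.comp_isClosedEmbedding hcl) 0
      rw [hA, integral_Ici_eq_integral_Ioi, ← this]
      congr 1; funext t
      exact ((hH.differentiable (by simp) _).hasFDerivAt.comp_hasDerivAt t (hd t)).deriv.symm
    have hmp := (volume_preserving_piFinSuccAbove (fun _ : Fin (n + 1) => ℝ) 0).symm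
    let F : (Fin (n + 1) → ℝ) → ℂ := fun x => fderiv ℝ H x (Pi.single 0 1)
    have hF : Integrable F :=
      (hH.fderiv_apply_const _).continuous.integrable_of_hasCompactSupport
        (hHc.fderiv_apply (𝕜 := ℝ) _)
    have hpre : (MeasurableEquiv.piFinSuccAbove (fun _ : Fin (n + 1) => ℝ) 0).symm ⁻¹'
        Ici (0 : Fin (n + 1) → ℝ) = Ici (0 : ℝ) ×ˢ Ici (0 : Fin n → ℝ) := by
      ext ⟨t, y⟩
      simp [MeasurableEquiv.piFinSuccAbove, Pi.le_def, Fin.forall_fin_succ]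
    have hemb := (MeasurableEquiv.piFinSuccAbove (fun _ : Fin (n + 1) => ℝ) 0).symm.measurableEmbedding
    have key := hmp.setIntegral_preimage_emb hemb F (Ici 0)
    rw [hpre] at key
    have hlist : (List.ofFn fun i : Fin (n + 1) => (Pi.single i 1 : Fin (n + 1) → ℝ)) =
        Pi.single 0 1 :: L := by
      simp [L, List.ofFn_succ]
    rw [hlist]
    change ∫ x in Ici (0 : Fin (n + 1) → ℝ), F x = _
    rw [← key, Measure.volume_eq_prod, ← setIntegral_prod_swap, setIntegral_prod]
    · have : ∀ (y : Fin n → ℝ) (t : ℝ),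
          (MeasurableEquiv.piFinSuccAbove (fun _ : Fin (n + 1) => ℝ) 0).symm (t, y) =
          Fin.cons t y := fun y t => by
        simp [MeasurableEquiv.piFinSuccAbove, Fin.consEquiv]
      simp only [Prod.swap_prod_mk, this]
      change ∫ y in Ici (0 : Fin n → ℝ), ∫ t in Ici (0 : ℝ),
        fderiv ℝ H (Fin.cons t y) (Pi.single 0 1) = _
      simp only [hslice]
      have h2 := dirDeriv_comp_affine A 0 hf (List.ofFn fun i : Fin n => (Pi.single i 1 : Fin n → ℝ))
      simp only [zero_add, ← hL] at h2
      have h3 := ih (f := fun y => f (A y)) (hf.comp A.contDiff) (hc.comp_isClosedEmbedding hAcl)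
      rw [h2] at h3
      rw [integral_neg, h3, map_zero]
      ring
    · have h := hmp.integrable_comp_emb hemb (g := F)
      have := (h.2 hF).swap
      exact this.integrableOn

lemma integral_cone_dirDeriv {n : ℕ} (A : (Fin n → ℝ) →L[ℝ] (Fin n → ℝ)) (hA : A.det ≠ 0)
    (v : Fin n → ℝ) {f : (Fin n → ℝ) → ℂ} (hf : ContDiff ℝ ∞ f) (hc : HasCompactSupport f) :
    ∫ x in (fun a => v + A a) '' Ici 0, dirDeriv (List.ofFn fun i => A (Pi.single i 1)) f x =
      (-1) ^ n * (|A.det| : ℝ) * f v := by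
  have hinj : Function.Injective A := (LinearMap.equivOfDetNeZero A.toLinearMap hA).injective
  have hcl : Topology.IsClosedEmbedding fun a => v + A a :=
    (Homeomorph.addLeft v).isClosedEmbedding.comp
      (LinearMap.isClosedEmbedding_of_injective (f := A.toLinearMap) (LinearMap.ker_eq_bot.2 hinj))
  rw [integral_image_eq_integral_abs_det_fderiv_smul volume measurableSet_Ici
    (fun x _ => (A.hasFDerivAt.const_add v).hasFDerivWithinAt) hcl.injective.injOn, integral_smul]
  have h := dirDeriv_comp_affine A v hf (List.ofFn fun i => Pi.single i 1)
  have h2 := integral_Ici_dirDeriv_single n (f := fun a => f (v + A a))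
    (hf.comp (contDiff_const.add A.contDiff)) (hc.comp_isClosedEmbedding hcl)
  rw [h, List.map_ofFn] at h2
  rw [show (List.ofFn fun i => A (Pi.single i 1)) =
    List.ofFn (A ∘ fun i => Pi.single i 1) from rfl, h2]
  simp only [map_zero, add_zero, Complex.real_smul]
  ring

lemma exists_add_smul_sub_mem_convexHull {ι E : Type*} [AddCommGroup E] [Module ℝ E]
    (V : Finset ι) (pt : ι → E) {p : E} (hp : p ∈ convexHull ℝ (pt '' V)) :
    ∃ i ∈ V, ∃ μ > (0 : ℝ), p + μ • (p - pt i) ∈ convexHull ℝ (pt '' V) := by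
  rw [← Finset.coe_image] at hp ⊢
  obtain ⟨c, hc0, hc1, hcp⟩ := Finset.mem_convexHull'.1 hp
  obtain ⟨u, hu, hcu⟩ : ∃ u ∈ V.image pt, 0 < c u := by
    by_contra! h
    have := Finset.sum_nonpos h
    linarith
  obtain ⟨i, hi, rfl⟩ := Finset.mem_image.1 hu
  refine ⟨i, hi, c (pt i), hcu, Finset.mem_convexHull'.2
    ⟨fun y => (1 + c (pt i)) * c y - if y = pt i then c (pt i) else 0, ?_, ?_, ?_⟩⟩
  · intro y hy
    beta_reduce
    split_ifs with h
    · subst h; nlinarith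
    · have := hc0 y hy
      simp only [sub_zero]; positivity
  · rw [Finset.sum_sub_distrib, ← Finset.mul_sum, hc1, Finset.sum_ite_eq', if_pos hu]
    ring
  · simp only [sub_smul, ite_smul, zero_smul, mul_smul]
    rw [Finset.sum_sub_distrib, ← Finset.smul_sum, hcp, Finset.sum_ite_eq', if_pos hu]
    module

/-- A convex set that agrees near `v` with a simplicial cone with apex `v` agrees with the same
cone near every point `p` from which it extends beyond, as seen from `v`. -/
lemma Convex.eventually_mem_iff_of_cone {n : ℕ} {P : Set (Fin n → ℝ)} (hP : Convex ℝ P)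
    (B : (Fin n → ℝ) →L[ℝ] (Fin n → ℝ)) {v p : Fin n → ℝ}
    (hloc : ∀ᶠ x in 𝓝 v, (x ∈ P ↔ 0 ≤ B (x - v))) {μ : ℝ} (hμ : 0 < μ)
    (hp : p ∈ P) (hq : p + μ • (p - v) ∈ P) :
    ∀ᶠ x in 𝓝 p, (x ∈ P ↔ 0 ≤ B (x - v)) := by
  have hv : v ∈ P := hloc.self_of_nhds.2 (by simp)
  have htend : ∀ x : Fin n → ℝ, Tendsto (fun t : ℝ => v + t • (x - v)) (𝓝[>] 0) (𝓝 v) := by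
    intro x
    have : Tendsto (fun t : ℝ => v + t • (x - v)) (𝓝 0) (𝓝 (v + (0 : ℝ) • (x - v))) := by
      apply Continuous.tendsto
      fun_prop
    simpa using this.mono_left nhdsWithin_le_nhds
  have hlt : ∀ᶠ t : ℝ in 𝓝[>] 0, 0 < t ∧ t < 1 :=
    Ioo_mem_nhdsGT one_pos
  have hsub : ∀ x ∈ P, 0 ≤ B (x - v) := by
    intro x hx
    obtain ⟨t, ht, ht0, ht1⟩ := (((htend x).eventually hloc).and hlt).exists
    have h1 : v + t • (x - v) ∈ P := hP.add_smul_sub_mem hv hx ⟨ht0.le, ht1.le⟩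
    have h2 := ht.1 h1
    rw [add_sub_cancel_left, map_smul] at h2
    intro i
    have := h2 i
    simp only [Pi.zero_apply, Pi.smul_apply, smul_eq_mul] at this ⊢
    exact nonneg_of_mul_nonneg_right this ht0
  obtain ⟨τ, hτloc, hτ0, hτ1⟩ := (((htend p).eventually hloc.eventually_nhds).and hlt).exists
  set s : ℝ := μ / (1 + μ - τ) with hs
  have hden : 0 < 1 + μ - τ := by linarith
  have hs0 : 0 < s := by positivity
  have hs1 : s ≤ 1 := by rw [hs, div_le_one hden]; linarith
  have hseq : s * (1 + μ - τ) = μ := div_mul_cancel₀ _ hden.ne'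
  let y : (Fin n → ℝ) → Fin n → ℝ := fun x => v + τ • (p - v) + s⁻¹ • (x - p)
  have hyc : Continuous y := by fun_prop
  have hyp : y p = v + τ • (p - v) := by simp [y]
  have hy1 : ∀ᶠ x in 𝓝 p, (y x ∈ P ↔ 0 ≤ B (y x - v)) := by
    have := hyc.tendsto p
    rw [hyp] at this
    exact this.eventually hτloc
  have hBy : ∀ x, B (y x - v) = τ • B (p - v) + s⁻¹ • (B (x - v) - B (p - v)) := by
    intro x
    rw [← map_sub, ← map_smul, ← map_smul, ← map_add]
    congr 1
    simp only [y]; module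
  have hy2 : ∀ᶠ x in 𝓝 p, 0 ≤ B (x - v) → 0 ≤ B (y x - v) := by
    have : ∀ᶠ x in 𝓝 p, ∀ i, 0 ≤ B (x - v) i → 0 ≤ B (y x - v) i := by
      rw [eventually_all]
      intro i
      rcases (hsub p hp i).eq_or_lt with h | h
      · refine Eventually.of_forall fun x hx => ?_
        simp only [Pi.zero_apply] at h
        simp only [hBy, Pi.add_apply, Pi.smul_apply, Pi.sub_apply, ← h, smul_eq_mul, mul_zero,
          zero_add, sub_zero]
        positivity
      · have hc : Continuous fun x => B (y x - v) i := by fun_prop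
        have hpos : 0 < B (y p - v) i := by
          simp only [hBy, sub_self, smul_zero, add_zero, Pi.smul_apply, smul_eq_mul]
          exact mul_pos hτ0 h
        filter_upwards [hc.tendsto p |>.eventually (lt_mem_nhds hpos)] with x hx _ using hx.le
    filter_upwards [this] with x hx h i using hx i (h i)
  filter_upwards [hy1, hy2] with x h1 h2
  refine ⟨hsub x, fun hx => ?_⟩
  have hyP : y x ∈ P := h1.2 (h2 hx)
  have := hP hyP hq hs0.le (sub_nonneg.2 hs1) (by ring)
  convert this using 1
  have e1 : s • s⁻¹ • (x - p) = x - p := smul_inv_smul₀ hs0.ne' _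
  have : s • y x + (1 - s) • (p + μ • (p - v)) =
      (s • s⁻¹ • (x - p)) + (s * τ + (1 - s) * (1 + μ)) • (p - v) + v := by
    simp only [y]; module
  rw [this, e1, show s * τ + (1 - s) * (1 + μ) = 1 by linarith]
  module

/-- The cone with apex `v` spanned by the images under `A` of the standard basis vectors. -/
def affineCone {n : ℕ} (v : Fin n → ℝ) (A : (Fin n → ℝ) →L[ℝ] (Fin n → ℝ)) : Set (Fin n → ℝ) :=
  (fun a => v + A a) '' Ici 0

lemma mem_affineCone_iff {n : ℕ} {A : (Fin n → ℝ) →L[ℝ] (Fin n → ℝ)} (hA : A.det ≠ 0)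
    (v x : Fin n → ℝ) :
    x ∈ affineCone v A ↔
      0 ≤ ((LinearMap.equivOfDetNeZero A.toLinearMap hA).toContinuousLinearEquiv.symm :
        (Fin n → ℝ) →L[ℝ] (Fin n → ℝ)) (x - v) := by
  set e := (LinearMap.equivOfDetNeZero A.toLinearMap hA).toContinuousLinearEquiv
  have he : ∀ a, e a = A a := fun a => rfl
  constructor
  · rintro ⟨a, ha, rfl⟩
    have : e.symm (A a) = a := by rw [← he]; exact e.symm_apply_apply a
    simpa [this] using ha
  · intro h
    refine ⟨e.symm (x - v), h, ?_⟩
    simp only [← he, ContinuousLinearEquiv.apply_symm_apply, add_sub_cancel]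

lemma isClosed_affineCone {n : ℕ} {A : (Fin n → ℝ) →L[ℝ] (Fin n → ℝ)} (hA : A.det ≠ 0)
    (v : Fin n → ℝ) : IsClosed (affineCone v A) := by
  have hcont : Continuous fun x =>
      (LinearMap.equivOfDetNeZero A.toLinearMap hA).toContinuousLinearEquiv.symm (x - v) :=
    (ContinuousLinearEquiv.continuous _).comp (continuous_id.sub continuous_const)
  convert isClosed_Ici.preimage hcont using 1
  exact Set.ext (mem_affineCone_iff hA v)

lemma det_ne_zero_of_eventually_mem_affineCone {n : ℕ} {P : Set (Fin n → ℝ)} (hP : Convex ℝ P)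
    (hfull : (interior P).Nonempty) {v : Fin n → ℝ} {A : (Fin n → ℝ) →L[ℝ] (Fin n → ℝ)}
    (hv : v ∈ P) (hloc : ∀ᶠ x in 𝓝 v, (x ∈ P ↔ x ∈ affineCone v A)) : A.det ≠ 0 := by
  intro hdet
  obtain ⟨U, hU, hUo, hvU⟩ := eventually_nhds_iff.1 hloc
  have hcl : v ∈ closure (interior P) := by
    rw [hP.closure_interior_eq_closure_of_nonempty_interior hfull]
    exact subset_closure hv
  have hne : (U ∩ interior P).Nonempty := mem_closure_iff.1 hcl U hUo hvU
  have hpos := (hUo.inter isOpen_interior).measure_pos volume hne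
  have hsub : U ∩ interior P ⊆ (fun x => v + x) '' (A.toLinearMap '' Ici 0) := by
    rintro x ⟨hxU, hxP⟩
    obtain ⟨a, ha, rfl⟩ := (hU x hxU).1 (interior_subset hxP)
    exact ⟨A a, ⟨a, ha, rfl⟩, rfl⟩
  refine hpos.ne' (measure_mono_null hsub ?_)
  rw [image_add_left, measure_preimage_add, Measure.addHaar_image_linearMap]
  have : LinearMap.det A.toLinearMap = 0 := hdet
  simp [this]

lemma setIntegral_eq_of_tsupport_subset {n : ℕ} {P C U : Set (Fin n → ℝ)}
    (hP : MeasurableSet P) (hC : MeasurableSet C) (hU : ∀ x ∈ U, (x ∈ P ↔ x ∈ C))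
    {g : (Fin n → ℝ) → ℂ} (hg : tsupport g ⊆ U) : ∫ x in P, g x = ∫ x in C, g x := by
  rw [← integral_indicator hP, ← integral_indicator hC]
  congr 1
  funext x
  by_cases hx : x ∈ U
  · simp only [indicator, hU x hx]
  · have : g x = 0 := image_eq_zero_of_notMem_tsupport fun h => hx (hg h)
    simp [indicator, this]

section Localization

variable {ι : Type*} {n : ℕ} {V : Finset ι} {pt : ι → Fin n → ℝ}
  {A : ι → (Fin n → ℝ) →L[ℝ] (Fin n → ℝ)} {P : Set (Fin n → ℝ)}

/-- All edge vectors at the vertices indexed by `V`. -/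
def edgeList (A : ι → (Fin n → ℝ) →L[ℝ] (Fin n → ℝ)) (V : Finset ι) : List (Fin n → ℝ) :=
  V.toList.flatMap fun i => List.ofFn fun j => A i (Pi.single j 1)

lemma edgeList_perm (A : ι → (Fin n → ℝ) →L[ℝ] (Fin n → ℝ)) {i : ι} (hi : i ∈ V) :
    (edgeList A V).Perm
      ((List.ofFn fun j => A i (Pi.single j 1)) ++ edgeList A (V.erase i)) := by
  have h : V.toList.Perm (i :: (V.erase i).toList) := by
    conv_lhs => rw [← Finset.insert_erase hi]
    exact Finset.toList_insert (Finset.notMem_erase i V)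
  simpa [edgeList] using h.flatMap_right fun i => List.ofFn fun j => A i (Pi.single j 1)

/-- The localization formula for integrals of iterated derivatives along all edge directions,
for functions supported near a given point. -/
lemma exists_local_integral_dirDeriv (hpt : InjOn pt V) (hPV : P = convexHull ℝ (pt '' V))
    (hfull : (interior P).Nonempty)
    (hloc : ∀ i ∈ V, ∀ᶠ x in 𝓝 (pt i), (x ∈ P ↔ x ∈ affineCone (pt i) (A i)))
    (p : Fin n → ℝ) :
    ∃ r > 0, ∀ f : (Fin n → ℝ) → ℂ, ContDiff ℝ ∞ f → tsupport f ⊆ Metric.ball p r →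
      ∫ x in P, dirDeriv (edgeList A V) f x =
        ∑ i ∈ V, (-1) ^ n * (|(A i).det| : ℝ) * dirDeriv (edgeList A (V.erase i)) f (pt i) := by
  have hfin : (pt '' V : Set (Fin n → ℝ)).Finite := V.finite_toSet.image pt
  have hPcl : IsClosed P := hPV ▸ hfin.isClosed_convexHull ℝ
  have hPconv : Convex ℝ P := hPV ▸ convex_convexHull ℝ _
  have hVP : ∀ i ∈ V, pt i ∈ P := fun i hi =>
    hPV ▸ subset_convexHull ℝ _ (mem_image_of_mem pt hi)
  have hdet : ∀ i ∈ V, (A i).det ≠ 0 := fun i hi =>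
    det_ne_zero_of_eventually_mem_affineCone hPconv hfull (hVP i hi) (hloc i hi)
  have hzero : ∀ {f : (Fin n → ℝ) → ℂ} {r : ℝ} {L : List (Fin n → ℝ)} {x : Fin n → ℝ},
      tsupport f ⊆ Metric.ball p r → x ∉ Metric.ball p r → dirDeriv L f x = 0 :=
    fun hf hx => image_eq_zero_of_notMem_tsupport fun h =>
      hx (hf (tsupport_dirDeriv_subset _ _ h))
  by_cases hp : p ∈ P
  · obtain ⟨i, hi, hi', hcone⟩ : ∃ i ∈ V, (∀ j ∈ V, pt j = p → j = i) ∧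
        ∀ᶠ x in 𝓝 p, (x ∈ P ↔ x ∈ affineCone (pt i) (A i)) := by
      by_cases hpV : ∃ i ∈ V, pt i = p
      · obtain ⟨i, hi, rfl⟩ := hpV
        exact ⟨i, hi, fun j hj h => hpt hj hi h, hloc i hi⟩
      · push Not at hpV
        obtain ⟨i, hi, μ, hμ, hq⟩ := exists_add_smul_sub_mem_convexHull V pt (hPV ▸ hp)
        rw [← hPV] at hq
        refine ⟨i, hi, fun j hj h => absurd h (hpV j hj), ?_⟩
        have := hloc i hi
        simp only [mem_affineCone_iff (hdet i hi)] at this ⊢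
        exact hPconv.eventually_mem_iff_of_cone _ this hμ hp hq
    have hsep : ∀ᶠ x in 𝓝 p, ∀ j ∈ V, x = pt j → pt j = p := by
      rw [Filter.eventually_all_finset]
      intro j _
      by_cases h : pt j = p
      · exact Eventually.of_forall fun _ _ => h
      · filter_upwards [isOpen_ne.mem_nhds (Ne.symm h)] with x hx hx' using absurd hx' hx
    obtain ⟨r, hr, hball⟩ := Metric.eventually_nhds_iff_ball.1 (hcone.and hsep)
    refine ⟨r, hr, fun f hf hfr => ?_⟩
    have hfc : HasCompactSupport f :=
      (isCompact_closedBall p r).of_isClosed_subset (isClosed_tsupport f)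
        (hfr.trans Metric.ball_subset_closedBall)
    rw [setIntegral_eq_of_tsupport_subset hPcl.measurableSet
      (isClosed_affineCone (hdet i hi) (pt i)).measurableSet (fun x hx => (hball x hx).1)
      ((tsupport_dirDeriv_subset f _).trans hfr), dirDeriv_perm hf (edgeList_perm A hi),
      dirDeriv_append, Finset.sum_eq_single_of_mem i hi]
    · exact integral_cone_dirDeriv (A i) (hdet i hi) (pt i) (hf.dirDeriv _) (hfc.dirDeriv _)
    · intro j hj hji
      rw [hzero hfr fun hx => hji (hi' j hj ((hball _ hx).2 j hj rfl)), mul_zero]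
  · obtain ⟨r, hr, hball⟩ := Metric.isOpen_iff.1 hPcl.isOpen_compl p hp
    refine ⟨r, hr, fun f hf hfr => ?_⟩
    have hPz : ∀ x ∈ P, ∀ L, dirDeriv L f x = 0 := fun x hx L =>
      hzero hfr fun h => hball h hx
    rw [setIntegral_eq_zero_of_forall_eq_zero fun x hx => hPz x hx _,
      Finset.sum_eq_zero fun i hi => by rw [hPz _ (hVP i hi), mul_zero]]

lemma integral_dirDeriv_edgeList (hpt : InjOn pt V) (hPV : P = convexHull ℝ (pt '' V))
    (hfull : (interior P).Nonempty)
    (hloc : ∀ i ∈ V, ∀ᶠ x in 𝓝 (pt i), (x ∈ P ↔ x ∈ affineCone (pt i) (A i)))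
    {f : (Fin n → ℝ) → ℂ} (hf : ContDiff ℝ ∞ f) :
    ∫ x in P, dirDeriv (edgeList A V) f x =
      ∑ i ∈ V, (-1) ^ n * (|(A i).det| : ℝ) * dirDeriv (edgeList A (V.erase i)) f (pt i) := by
  choose r hr hlocal using exists_local_integral_dirDeriv hpt hPV hfull hloc
  have hfin : (pt '' V : Set (Fin n → ℝ)).Finite := V.finite_toSet.image pt
  have hPcomp : IsCompact P := hPV ▸ hfin.isCompact_convexHull ℝ
  have hVP : ∀ i ∈ V, pt i ∈ P := fun i hi =>
    hPV ▸ subset_convexHull ℝ _ (mem_image_of_mem pt hi)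
  obtain ⟨φ, hφ⟩ := SmoothPartitionOfUnity.exists_isSubordinate 𝓘(ℝ, Fin n → ℝ)
    (isClosed_univ (X := Fin n → ℝ)) (fun p => Metric.ball p (r p)) (fun p => Metric.isOpen_ball)
    (fun p _ => mem_iUnion.2 ⟨p, Metric.mem_ball_self (hr p)⟩)
  have hK : IsCompact (Metric.cthickening 1 P) := hPcomp.cthickening
  let I := (φ.locallyFinite.finite_nonempty_inter_compact hK).toFinset
  let g : (Fin n → ℝ) → (Fin n → ℝ) → ℂ := fun p x => (φ p x : ℂ) * f x
  have hg : ∀ p, ContDiff ℝ ∞ (g p) := fun p =>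
    (Complex.ofRealCLM.contDiff.comp (contMDiff_iff_contDiff.1 (φ p).contMDiff)).mul hf
  have hgs : ∀ p, tsupport (g p) ⊆ Metric.ball p (r p) := fun p => by
    refine (closure_mono fun x hx => ?_).trans (hφ p)
    simp only [g, Function.mem_support, ne_eq, mul_eq_zero, not_or, Complex.ofReal_eq_zero] at hx
    exact hx.1
  have hsum : ∀ x ∈ P, f =ᶠ[𝓝 x] fun y => ∑ p ∈ I, g p y := by
    intro x hx
    have hnhds : Metric.cthickening 1 P ∈ 𝓝 x :=
      mem_of_superset (Metric.isOpen_thickening.mem_nhds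
        (Metric.self_subset_thickening one_pos P hx)) (Metric.thickening_subset_cthickening 1 P)
    filter_upwards [hnhds] with y hy
    have h1 := φ.sum_eq_one (mem_univ y)
    rw [finsum_eq_sum_of_support_subset (s := I)] at h1
    · simp only [g, ← Finset.sum_mul, ← Complex.ofReal_sum, h1, Complex.ofReal_one, one_mul]
    · intro p hp
      simp only [I, Finite.coe_toFinset]
      exact ⟨y, hp, hy⟩
  have hD : ∀ L, ∀ x ∈ P, dirDeriv L f x = ∑ p ∈ I, dirDeriv L (g p) x := by
    intro L x hx
    rw [((hsum x hx).dirDeriv L).self_of_nhds, dirDeriv_sum I fun p _ => hg p]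
  rw [setIntegral_congr_fun hPcomp.measurableSet (hD _), integral_finsetSum,
    Finset.sum_congr rfl fun p _ => hlocal p (g p) (hg p) (hgs p), Finset.sum_comm]
  · refine Finset.sum_congr rfl fun i hi => ?_
    rw [hD _ _ (hVP i hi), Finset.mul_sum]
  · exact fun p _ => ((hg p).dirDeriv _).continuous.continuousOn.integrableOn_compact hPcomp

lemma integral_cexp_eq_sum (hpt : InjOn pt V) (hPV : P = convexHull ℝ (pt '' V))
    (hfull : (interior P).Nonempty)
    (hloc : ∀ i ∈ V, ∀ᶠ x in 𝓝 (pt i), (x ∈ P ↔ x ∈ affineCone (pt i) (A i)))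
    (ℓ : (Fin n → ℝ) →L[ℝ] ℂ) (hℓ : ∀ i ∈ V, ∀ j, ℓ (A i (Pi.single j 1)) ≠ 0) :
    ∫ x in P, Complex.exp (ℓ x) =
      ∑ i ∈ V, (|(A i).det| : ℝ) * Complex.exp (ℓ (pt i)) *
        ∏ j, (-1) / ℓ (A i (Pi.single j 1)) := by
  have h := integral_dirDeriv_edgeList hpt hPV hfull hloc (f := fun x => Complex.exp (ℓ x))
    ℓ.contDiff.cexp
  simp only [dirDeriv_cexp] at h
  rw [integral_const_mul] at h
  have hne : ((edgeList A V).map ℓ).prod ≠ 0 := by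
    rw [Ne, List.prod_eq_zero_iff]
    simp only [edgeList, List.mem_map, List.mem_flatMap, Finset.mem_toList, List.mem_ofFn]
    rintro ⟨_, ⟨i, hi, j, rfl⟩, h0⟩
    exact hℓ i hi j h0
  rw [← mul_right_inj' hne, h, Finset.mul_sum]
  refine Finset.sum_congr rfl fun i hi => ?_
  have hprod : ((edgeList A V).map ℓ).prod =
      (∏ j, ℓ (A i (Pi.single j 1))) * ((edgeList A (V.erase i)).map ℓ).prod := by
    rw [((edgeList_perm A hi).map ℓ).prod_eq, List.map_append, List.prod_append, List.map_ofFn,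
      List.prod_ofFn]
    rfl
  have hi0 : ∏ j, ℓ (A i (Pi.single j 1)) ≠ 0 := Finset.prod_ne_zero_iff.2 fun j _ => hℓ i hi j
  rw [hprod, Finset.prod_div_distrib, Finset.prod_const, Finset.card_univ, Fintype.card_fin]
  field_simp

end Localization

lemma castZ_injective {n : ℕ} : Function.Injective (castZ (n := n)) := fun x y h => by
  funext i
  exact Int.cast_injective (α := ℝ) (congrFun h i)

/-- The linear map sending the standard basis to the vectors `w i`. -/
def edgeMap {n : ℕ} (w : Fin n → Fin n → ℤ) : (Fin n → ℝ) →L[ℝ] (Fin n → ℝ) :=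
  (Matrix.toLin' (Matrix.of fun i j => (w j i : ℝ))).toContinuousLinearMap

lemma edgeMap_apply {n : ℕ} (w : Fin n → Fin n → ℤ) (a : Fin n → ℝ) :
    edgeMap w a = ∑ i, a i • castZ (w i) := by
  ext j
  simp [edgeMap, Matrix.mulVec, dotProduct, castZ, mul_comm]

lemma edgeMap_single {n : ℕ} (w : Fin n → Fin n → ℤ) (j : Fin n) :
    edgeMap w (Pi.single j 1) = castZ (w j) := by
  ext i
  simp [edgeMap, castZ]

lemma det_edgeMap {n : ℕ} (w : Fin n → Fin n → ℤ) :
    (edgeMap w).det = (Matrix.of fun i j => (w j i : ℝ)).det :=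
  LinearMap.det_toLin' _

lemma tanCone_eq_affineCone {n : ℕ} (v : Fin n → ℝ) (w : Fin n → Fin n → ℤ) :
    tanCone v w = affineCone v (edgeMap w) := by
  ext x
  simp only [tanCone, affineCone, edgeMap_apply, mem_ofPred_eq, mem_image, mem_Ici, Pi.le_def,
    Pi.zero_apply, eq_comm (a := x)]

/-- The pairing with `z` as a continuous linear map. -/
def pairCLM {n : ℕ} (z : Fin n → ℂ) : (Fin n → ℝ) →L[ℝ] ℂ :=
  ∑ j, (ContinuousLinearMap.proj (R := ℝ) (φ := fun _ : Fin n => ℝ) j).smulRight (z j)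

lemma pairCLM_apply {n : ℕ} (z : Fin n → ℂ) (m : Fin n → ℝ) : pairCLM z m = pairC m z := by
  simp [pairCLM, pairC]
/-- Let `P ⊂ ℝ^n` be a full-dimensional simple lattice polytope (the convex
hull of the finite lattice set `S`, with nonempty interior, where at each vertex `v` the
tangent cone of `P` is the simplicial cone spanned by the primitive lattice edge vectors
`w v 1, …, w v n` pointing from `v` into `P`).  For every `z ∈ ℂ^n` such that
`⟨w_{v,i}, z⟩ ≠ 0` for all vertices `v` and all `i`, one has the vertex localization formula
`∫_P e^{⟨m,z⟩} dλ(m) = ∑_{v vertex} |det(w_{v,1},…,w_{v,n})| e^{⟨v,z⟩} ∏ᵢ (-1)/⟨w_{v,i},z⟩`. -/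
theorem stmt6 (n : ℕ) (S : Finset (Fin n → ℤ))
    (P : Set (Fin n → ℝ)) (hP : P = convexHull ℝ (castZ '' ↑S))
    (hfull : (interior P).Nonempty)
    (w : (Fin n → ℤ) → Fin n → Fin n → ℤ)
    (hvert : ∀ v ∈ S, castZ v ∈ P.extremePoints ℝ →
      (∀ i, Finset.univ.gcd (w v i) = 1) ∧
      ∃ ε > 0, P ∩ Metric.ball (castZ v) ε =
        tanCone (castZ v) (w v) ∩ Metric.ball (castZ v) ε)
    (z : Fin n → ℂ)
    (hz : ∀ v ∈ S, castZ v ∈ P.extremePoints ℝ → ∀ i, pairC (castZ (w v i)) z ≠ 0) :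
    ∫ m in P, Complex.exp (pairC m z) ∂volume =
      ∑ v ∈ S.filter (fun v => castZ v ∈ P.extremePoints ℝ),
        ((|(Matrix.of fun i j => (w v j i : ℝ)).det| : ℝ) : ℂ) *
          Complex.exp (pairC (castZ v) z) *
          ∏ i, (-1) / pairC (castZ (w v i)) z := by
  set V := S.filter fun v => castZ v ∈ P.extremePoints ℝ with hV
  have hfin : (castZ '' (S : Set (Fin n → ℤ))).Finite := S.finite_toSet.image _
  have hext : castZ '' (V : Set (Fin n → ℤ)) = P.extremePoints ℝ := by
    ext x
    simp only [hV, Finset.coe_filter, mem_image, mem_ofPred_eq]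
    constructor
    · rintro ⟨v, hv, rfl⟩
      exact hv.2
    · intro hx
      obtain ⟨v, hv, rfl⟩ := extremePoints_convexHull_subset (𝕜 := ℝ) (hP ▸ hx)
      exact ⟨v, ⟨hv, hx⟩, rfl⟩
  have hPV : P = convexHull ℝ (castZ '' (V : Set (Fin n → ℤ))) := by
    have hcomp : IsCompact P := hP ▸ hfin.isCompact_convexHull ℝ
    have hconv : Convex ℝ P := hP ▸ convex_convexHull ℝ _
    have hVfin : (castZ '' (V : Set (Fin n → ℤ))).Finite := V.finite_toSet.image _
    rw [← (hVfin.isClosed_convexHull ℝ).closure_eq, hext,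
      closure_convexHull_extremePoints hcomp hconv]
  have hloc : ∀ v ∈ V, ∀ᶠ x in 𝓝 (castZ v),
      (x ∈ P ↔ x ∈ affineCone (castZ v) (edgeMap (w v))) := by
    intro v hv
    obtain ⟨hvS, hve⟩ := Finset.mem_filter.1 hv
    obtain ⟨-, ε, hε, h⟩ := hvert v hvS hve
    rw [← tanCone_eq_affineCone]
    filter_upwards [Metric.ball_mem_nhds _ hε] with x hx
    simpa [hx] using Set.ext_iff.1 h x
  have h := integral_cexp_eq_sum castZ_injective.injOn hPV hfull hloc (pairCLM z) (by
    intro v hv j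
    obtain ⟨hvS, hve⟩ := Finset.mem_filter.1 hv
    rw [edgeMap_single, pairCLM_apply]
    exact hz v hvS hve j)
  simpa only [pairCLM_apply, edgeMap_single, det_edgeMap] using h
end
end

section
/- For every polynomial function $f : \mathbb{R}^n \to \mathbb{R}$ of degree $d$ there exist a neighborhood $U$ of $0$ in $\mathbb{R}^r$ and a polynomial $q_f \in \mathbb{R}[h_1,\dots,h_r]$ of total degree at most $d + n$ such that $\int_{P(h)} f\, d\lambda = q_f(h)$ for all $h \in U$. -/
open MeasureTheory

noncomputable section

/-- The pairing `⟨m, u⟩ = ∑ i, m i * u i` of a real vector with a lattice vector. -/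
def pairR {n : ℕ} (m : Fin n → ℝ) (u : Fin n → ℤ) : ℝ := ∑ i, m i * (u i : ℝ)

/-- The polytope `P = {m : ⟨m, uⱼ⟩ + cⱼ ≥ 0 for all j}`. -/
def Pset {n r : ℕ} (u : Fin r → Fin n → ℤ) (c : Fin r → ℤ) : Set (Fin n → ℝ) :=
  {m | ∀ j, 0 ≤ pairR m (u j) + (c j : ℝ)}

/-- The dilated polytope `P(h) = {m : ⟨m, uⱼ⟩ + cⱼ + hⱼ ≥ 0 for all j}`. -/
def Ph {n r : ℕ} (u : Fin r → Fin n → ℤ) (c : Fin r → ℤ) (h : Fin r → ℝ) :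
    Set (Fin n → ℝ) :=
  {m | ∀ j, 0 ≤ pairR m (u j) + (c j : ℝ) + h j}

/-- The `j`-th facet `Fⱼ = {m ∈ P : ⟨m, uⱼ⟩ + cⱼ = 0}` of `P`. -/
def Fface {n r : ℕ} (u : Fin r → Fin n → ℤ) (c : Fin r → ℤ) (j : Fin r) :
    Set (Fin n → ℝ) :=
  {m | m ∈ Pset u c ∧ pairR m (u j) + (c j : ℝ) = 0}

/-- `F` is given by a polynomial of total degree at most `D`. -/
def IsPolyOfDegreeLE {ι : Type} (D : ℕ) (F : (ι → ℝ) → ℝ) : Prop :=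
  ∃ q : MvPolynomial ι ℝ, q.totalDegree ≤ D ∧ ∀ h, F h = MvPolynomial.eval h q

namespace IsPolyOfDegreeLE

variable {ι κ : Type} {D E : ℕ} {F G : (ι → ℝ) → ℝ}

theorem mono (hF : IsPolyOfDegreeLE D F) (h : D ≤ E) : IsPolyOfDegreeLE E F := by
  obtain ⟨q, hq, hq'⟩ := hF
  exact ⟨q, hq.trans h, hq'⟩

theorem const (c : ℝ) : IsPolyOfDegreeLE D (fun _ : ι → ℝ => c) :=
  ⟨MvPolynomial.C c, by simp, fun h => by simp⟩

theorem coord (i : ι) : IsPolyOfDegreeLE 1 (fun h : ι → ℝ => h i) :=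
  ⟨MvPolynomial.X i, by simp, fun h => by simp⟩

theorem add (hF : IsPolyOfDegreeLE D F) (hG : IsPolyOfDegreeLE D G) :
    IsPolyOfDegreeLE D (fun h => F h + G h) := by
  obtain ⟨p, hp, hp'⟩ := hF
  obtain ⟨q, hq, hq'⟩ := hG
  exact ⟨p + q, (MvPolynomial.totalDegree_add _ _).trans (max_le hp hq),
    fun h => by simp [hp', hq']⟩

theorem mul (hF : IsPolyOfDegreeLE D F) (hG : IsPolyOfDegreeLE E G) :
    IsPolyOfDegreeLE (D + E) (fun h => F h * G h) := by
  obtain ⟨p, hp, hp'⟩ := hF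
  obtain ⟨q, hq, hq'⟩ := hG
  exact ⟨p * q, (MvPolynomial.totalDegree_mul _ _).trans (add_le_add hp hq),
    fun h => by simp [hp', hq']⟩

theorem const_mul (c : ℝ) (hF : IsPolyOfDegreeLE D F) :
    IsPolyOfDegreeLE D (fun h => c * F h) := by
  simpa using (const (D := 0) c).mul hF

theorem sub (hF : IsPolyOfDegreeLE D F) (hG : IsPolyOfDegreeLE D G) :
    IsPolyOfDegreeLE D (fun h => F h - G h) := by
  simpa [sub_eq_add_neg] using hF.add (hG.const_mul (-1))

theorem pow (hF : IsPolyOfDegreeLE 1 F) (k : ℕ) : IsPolyOfDegreeLE k (fun h => F h ^ k) := by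
  induction k with
  | zero => simpa using const 1
  | succ k ih => simpa [pow_succ] using ih.mul hF

theorem sum {α : Type} (s : Finset α) {F : α → (ι → ℝ) → ℝ}
    (hF : ∀ a ∈ s, IsPolyOfDegreeLE D (F a)) :
    IsPolyOfDegreeLE D (fun h => ∑ a ∈ s, F a h) := by
  classical
  induction s using Finset.induction_on with
  | empty => simpa using const 0
  | insert a s ha ih =>
    simpa [Finset.sum_insert ha] using (hF a (by simp)).add (ih fun b hb => hF b (by simp [hb]))

theorem prod {α : Type} (s : Finset α) {F : α → (ι → ℝ) → ℝ} {D : α → ℕ}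
    (hF : ∀ a ∈ s, IsPolyOfDegreeLE (D a) (F a)) :
    IsPolyOfDegreeLE (∑ a ∈ s, D a) (fun h => ∏ a ∈ s, F a h) := by
  classical
  induction s using Finset.induction_on with
  | empty => simpa using const 1
  | insert a s ha ih =>
    simpa [Finset.sum_insert ha, Finset.prod_insert ha] using
      (hF a (by simp)).mul (ih fun b hb => hF b (by simp [hb]))

theorem exists_monomials [Fintype ι] (hF : IsPolyOfDegreeLE D F) :
    ∃ (s : Finset (ι →₀ ℕ)) (c : (ι →₀ ℕ) → ℝ), (∀ m ∈ s, ∑ i, m i ≤ D) ∧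
      ∀ h, F h = ∑ m ∈ s, c m * ∏ i, h i ^ m i := by
  obtain ⟨q, hq, hq'⟩ := hF
  refine ⟨q.support, fun m => q.coeff m, fun m hm => ?_, fun h => ?_⟩
  · have := (MvPolynomial.le_totalDegree hm).trans hq
    rwa [Finsupp.sum_fintype _ _ (by simp)] at this
  · rw [hq', MvPolynomial.eval_eq']

theorem comp [Fintype ι] (hF : IsPolyOfDegreeLE D F) {g : (κ → ℝ) → ι → ℝ}
    (hg : ∀ i, IsPolyOfDegreeLE 1 (fun h => g h i)) :
    IsPolyOfDegreeLE D (fun h => F (g h)) := by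
  obtain ⟨s, c, hs, hF⟩ := hF.exists_monomials
  simp only [hF]
  exact sum _ fun m hm =>
    ((prod Finset.univ fun i _ => (hg i).pow (m i)).mono (hs m hm)).const_mul _

theorem linear [Fintype ι] (l : (ι → ℝ) →ₗ[ℝ] ℝ) : IsPolyOfDegreeLE 1 l := by
  classical
  have h : (l : (ι → ℝ) → ℝ) = fun x => ∑ i, l (fun k => if i = k then 1 else 0) * x i := by
    ext x
    rw [l.pi_apply_eq_sum_univ x]
    exact Finset.sum_congr rfl fun i _ => by simp [mul_comm]
  rw [h]
  exact sum _ fun i _ => (coord i).const_mul _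

theorem continuous (hF : IsPolyOfDegreeLE D F) : Continuous F := by
  obtain ⟨q, -, hq⟩ := hF
  rw [funext hq]
  exact MvPolynomial.continuous_eval q

/-- Integrating out one variable between affine bounds raises the degree by at most one. -/
theorem intervalIntegral [Fintype ι] {F : (Option ι → ℝ) → ℝ} (hF : IsPolyOfDegreeLE D F)
    {A B : (ι → ℝ) → ℝ} (hA : IsPolyOfDegreeLE 1 A) (hB : IsPolyOfDegreeLE 1 B) :
    IsPolyOfDegreeLE (D + 1)
      (fun h => ∫ t in A h..B h, F (fun o => o.elim t h)) := by
  obtain ⟨s, c, hs, hF⟩ := hF.exists_monomials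
  have key : ∀ h : ι → ℝ, ∫ t in A h..B h, F (fun o => o.elim t h) =
      ∑ m ∈ s, (c m * ((m none + 1 : ℝ)⁻¹)) * ((B h ^ (m none + 1) - A h ^ (m none + 1)) *
        ∏ i, h i ^ m (some i)) := by
    intro h
    simp only [hF, Fintype.prod_option, Option.elim]
    rw [intervalIntegral.integral_finsetSum]
    · refine Finset.sum_congr rfl fun m _ => ?_
      rw [intervalIntegral.integral_const_mul, intervalIntegral.integral_mul_const, integral_pow]
      ring
    · intro m _
      exact (by fun_prop : Continuous _).intervalIntegrable _ _
  simp only [key]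
  refine sum _ fun m hm => const_mul _ ?_
  refine (((hB.pow _).sub (hA.pow _)).mul
    (prod Finset.univ fun i _ => (coord i).pow (m (some i)))).mono ?_
  have := hs m hm
  rw [Fintype.sum_option] at this
  omega

end IsPolyOfDegreeLE


section HalfSpaces

variable {ι V : Type} [NormedAddCommGroup V] [NormedSpace ℝ V]

/-- The intersection of the half-spaces `0 ≤ a i x + b i`, `i ∈ s`. -/
def halfSpaces (s : Finset ι) (a : ι → V →L[ℝ] ℝ) (b : ι → ℝ) : Set V :=
  {x | ∀ i ∈ s, 0 ≤ a i x + b i}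

variable {s : Finset ι} {a : ι → V →L[ℝ] ℝ}

theorem isClosed_halfSpaces (b : ι → ℝ) : IsClosed (halfSpaces s a b) := by
  simp only [halfSpaces, Set.ofPred_forall]
  exact isClosed_biInter fun i _ => isClosed_le continuous_const (by fun_prop)

theorem norm_le_of_mem_halfSpaces [FiniteDimensional ℝ V]
    (ha : ∀ x, (∀ i ∈ s, 0 ≤ a i x) → x = 0) :
    ∃ C : ℝ, 0 ≤ C ∧ ∀ b, ∀ x ∈ halfSpaces s a b, ‖x‖ ≤ C * ∑ i ∈ s, |b i| := by
  let g : V → ℝ := fun x => ∑ i ∈ s, max 0 (-a i x)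
  have hg : Continuous g := by fun_prop
  have hg0 : ∀ x, x ≠ 0 → 0 < g x := by
    intro x hx
    have h0 : 0 ≤ g x := Finset.sum_nonneg fun i _ => le_max_left _ _
    refine h0.lt_of_ne fun h => hx (ha x fun i hi => ?_)
    have := (Finset.sum_eq_zero_iff_of_nonneg fun i _ => le_max_left _ _).1 h.symm i hi
    have h2 := le_max_right 0 (-a i x)
    linarith
  obtain ⟨ε, hε, hε'⟩ : ∃ ε : ℝ, 0 < ε ∧ ∀ x ∈ Metric.sphere (0 : V) 1, ε ≤ g x := by
    have : ProperSpace V := FiniteDimensional.proper ℝ V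
    rcases (Metric.sphere (0 : V) 1).eq_empty_or_nonempty with h | h
    · exact ⟨1, one_pos, by simp [h]⟩
    · obtain ⟨y, hy, hy'⟩ := (isCompact_sphere (0 : V) 1).exists_isMinOn h hg.continuousOn
      exact ⟨g y, hg0 y (by rintro rfl; simp at hy), hy'⟩
  refine ⟨ε⁻¹, by positivity, fun b x hx => ?_⟩
  by_cases hx0 : x = 0
  · subst hx0
    rw [norm_zero]
    positivity
  have hn : 0 < ‖x‖ := norm_pos_iff.2 hx0
  have h1 := hε' (‖x‖⁻¹ • x) (by simp [norm_smul, hn.ne'])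
  have h2 : g (‖x‖⁻¹ • x) = ‖x‖⁻¹ * g x := by
    simp only [g, Finset.mul_sum]
    refine Finset.sum_congr rfl fun i _ => ?_
    rw [mul_max_of_nonneg _ _ (by positivity)]
    simp
  have h3 : g x ≤ ∑ i ∈ s, |b i| := Finset.sum_le_sum fun i hi =>
    max_le (abs_nonneg _) (by linarith [hx i hi, le_abs_self (b i)])
  rw [h2, ← div_eq_inv_mul, le_div_iff₀ hn] at h1
  rw [← div_eq_inv_mul, le_div_iff₀ hε]
  linarith

theorem isCompact_halfSpaces [FiniteDimensional ℝ V]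
    (ha : ∀ x, (∀ i ∈ s, 0 ≤ a i x) → x = 0) (b : ι → ℝ) : IsCompact (halfSpaces s a b) := by
  have : ProperSpace V := FiniteDimensional.proper ℝ V
  obtain ⟨C, -, hC⟩ := norm_le_of_mem_halfSpaces ha
  refine Metric.isCompact_of_isClosed_isBounded (isClosed_halfSpaces b)
    ((Metric.isBounded_closedBall (x := (0 : V)) (r := C * ∑ i ∈ s, |b i|)).subset fun x hx => ?_)
  simpa using hC b x hx

/-- Emptiness of a system of inequalities without recession directions is stable. -/
theorem eventually_halfSpaces_eq_empty [FiniteDimensional ℝ V]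
    (ha : ∀ x, (∀ i ∈ s, 0 ≤ a i x) → x = 0) {b : ι → ℝ} (hb : halfSpaces s a b = ∅) :
    ∀ᶠ h in nhds (0 : ι → ℝ), halfSpaces s a (b + h) = ∅ := by
  have : ProperSpace V := FiniteDimensional.proper ℝ V
  obtain ⟨C, hC0, hC⟩ := norm_le_of_mem_halfSpaces ha
  have h1 : ∀ᶠ h in nhds (0 : ι → ℝ), ∑ i ∈ s, |(b + h) i| < (∑ i ∈ s, |b i|) + 1 := by
    have : Continuous fun h : ι → ℝ => ∑ i ∈ s, |(b + h) i| := by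
      simp only [Pi.add_apply]; fun_prop
    exact this.continuousAt.eventually_lt continuousAt_const (by simp)
  have h2 := (isCompact_closedBall (0 : V) (C * ((∑ i ∈ s, |b i|) + 1))
    ).eventually_forall_of_forall_eventually (x₀ := (0 : ι → ℝ))
    (P := fun h x => x ∉ halfSpaces s a (b + h)) (by
      intro x _
      have hx : x ∉ halfSpaces s a b := by simp [hb]
      simp only [halfSpaces, Set.mem_ofPred_eq, not_forall, not_le] at hx
      obtain ⟨i, hi, hx⟩ := hx
      have hc : Continuous fun z : (ι → ℝ) × V => a i z.2 + (b + z.1) i := by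
        simp only [Pi.add_apply]; fun_prop
      have := hc.continuousAt (x := (0, x)) |>.eventually_lt
        (continuousAt_const (y := (0 : ℝ))) (by simpa using hx)
      filter_upwards [this] with z hz hz'
      exact (hz' i hi).not_gt hz)
  filter_upwards [h1, h2] with h h1 h2
  refine Set.eq_empty_of_forall_notMem fun x hx => h2 x ?_ hx
  simpa using (hC _ x hx).trans (by gcongr)

/-- The normals of the constraints active at any point of the set are linearly independent. -/
def ActiveIndependent [Fintype ι] (s : Finset ι) (a : ι → V →L[ℝ] ℝ) (b : ι → ℝ) : Prop :=
  ∀ x ∈ halfSpaces s a b, ∀ c : ι → ℝ, (∀ i, i ∉ s ∨ a i x + b i ≠ 0 → c i = 0) →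
    ∑ i, c i • a i = 0 → ∀ i, c i = 0

end HalfSpaces

theorem exists_prod_equiv {n : ℕ} {φ : (Fin (n + 1) → ℝ) →L[ℝ] ℝ} (hφ : φ ≠ 0) :
    ∃ e : (ℝ × (Fin n → ℝ)) ≃L[ℝ] (Fin (n + 1) → ℝ), ∀ p, φ (e p) = p.1 := by
  obtain ⟨v, hv⟩ : ∃ v, φ v ≠ 0 := by
    by_contra! h
    exact hφ (by ext v; simp [h])
  have hr : Function.RightInverse
      (ContinuousLinearMap.toSpanSingleton ℝ ((φ v)⁻¹ • v)) φ := by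
    intro t
    simp [hv]
  let e₁ := ContinuousLinearEquiv.equivOfRightInverse φ _ hr
  have hd : Module.finrank ℝ (Fin n → ℝ) = Module.finrank ℝ φ.ker := by
    have := e₁.toLinearEquiv.finrank_eq
    simp at this
    simp
    omega
  let e₂ := ContinuousLinearEquiv.ofFinrankEq hd
  refine ⟨((ContinuousLinearEquiv.refl ℝ ℝ).prodCongr e₂).trans e₁.symm, fun p => ?_⟩
  have := ContinuousLinearEquiv.fst_equivOfRightInverse φ _ hr (e₁.symm (p.1, e₂ p.2))
  change (e₁ (e₁.symm (p.1, e₂ p.2))).1 = _ at this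
  rw [e₁.apply_symm_apply] at this
  exact this.symm

theorem exists_integral_comp_equiv {n : ℕ}
    (e : (ℝ × (Fin n → ℝ)) ≃L[ℝ] (Fin (n + 1) → ℝ)) :
    ∃ c : ℝ, ∀ g : (Fin (n + 1) → ℝ) → ℝ, ∫ x, g x = c * ∫ p, g (e p) := by
  have := e.symm.isAddHaarMeasure_map (volume : Measure (Fin (n + 1) → ℝ))
  have : (volume : Measure (ℝ × (Fin n → ℝ))).IsAddHaarMeasure :=
    inferInstanceAs ((volume : Measure ℝ).prod (volume : Measure (Fin n → ℝ))).IsAddHaarMeasure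
  obtain ⟨c, hc⟩ : ∃ c : NNReal, Measure.map e.symm (volume : Measure (Fin (n + 1) → ℝ)) =
      c • (volume : Measure (ℝ × (Fin n → ℝ))) :=
    ⟨_, Measure.isAddLeftInvariant_eq_smul _ _⟩
  refine ⟨c, fun g => ?_⟩
  have h := e.symm.toHomeomorph.measurableEmbedding.integral_map
    (μ := (volume : Measure (Fin (n + 1) → ℝ))) (fun p => g (e p))
  change ∫ p, g (e p) ∂(Measure.map e.symm volume) = _ at h
  rw [hc, integral_smul_nnreal_measure] at h
  simpa [NNReal.smul_def] using h.symm

section Slices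

variable {ι : Type} [Fintype ι] [DecidableEq ι] {n : ℕ}

/-- The integral over the slice `φ = t` is polynomial in `t` and in the parameters. -/
theorem slice_integral {s : Finset ι} {a : ι → (Fin (n + 1) → ℝ) →L[ℝ] ℝ} {b : ι → ℝ}
    (ih : ∀ (s : Finset ι) (a : ι → (Fin n → ℝ) →L[ℝ] ℝ) (b : ι → ℝ),
      (∀ x, (∀ i ∈ s, 0 ≤ a i x) → x = 0) → ActiveIndependent s a b →
      ∀ (d : ℕ) (F : (Fin n → ℝ) → ℝ), IsPolyOfDegreeLE d F →
      ∃ G : (ι → ℝ) → ℝ, IsPolyOfDegreeLE (d + n) G ∧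
        ∀ᶠ h in nhds (0 : ι → ℝ), ∫ x in halfSpaces s a (b + h), F x = G h)
    (ha : ∀ x, (∀ i ∈ s, 0 ≤ a i x) → x = 0) (hind : ActiveIndependent s a b)
    {d : ℕ} {F : (Fin (n + 1) → ℝ) → ℝ} (hF : IsPolyOfDegreeLE d F) {j : ι} (hj : j ∈ s)
    (e : (ℝ × (Fin n → ℝ)) ≃L[ℝ] (Fin (n + 1) → ℝ)) (he : ∀ p, a j (e p) = p.1) :
    ∃ G : (Option ι → ℝ) → ℝ, IsPolyOfDegreeLE (d + n) G ∧
      ∀ᶠ z : ℝ × (ι → ℝ) in nhds (-b j, 0),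
        ∫ y in {y | ∀ i ∈ s.erase j, 0 ≤ a i (e (z.1, y)) + (b + z.2) i}, F (e (z.1, y)) =
          G (fun o => o.elim z.1 z.2) := by
  let a' : ι → (Fin n → ℝ) →L[ℝ] ℝ := fun i =>
    (a i).comp ((e : _ →L[ℝ] _).comp (ContinuousLinearMap.inr ℝ ℝ (Fin n → ℝ)))
  let α : ι → ℝ := fun i => a i (e (1, 0))
  have hsplit : ∀ i t y, a i (e (t, y)) = a' i y + t * α i := by
    intro i t y
    have : ((t, y) : ℝ × (Fin n → ℝ)) = (0, y) + t • (1, 0) := by simp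
    rw [this, map_add, map_smul, map_add, map_smul]
    rfl
  let b' : ι → ℝ := fun i => b i - b j * α i
  have ha' : ∀ y, (∀ i ∈ s.erase j, 0 ≤ a' i y) → y = 0 := by
    intro y hy
    have h0 : e (0, y) = 0 := by
      refine ha _ fun i hi => ?_
      by_cases hij : i = j
      · subst hij; rw [he]
      · simpa [hsplit] using hy i (Finset.mem_erase.2 ⟨hij, hi⟩)
    have := (e.map_eq_zero_iff).1 h0
    exact (Prod.ext_iff.1 this).2
  have hind' : ActiveIndependent (s.erase j) a' b' := by
    intro y hy c hc hsum
    have hval : ∀ i, a i (e (-b j, y)) + b i = a' i y + b' i := by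
      intro i; rw [hsplit]; simp only [b']; ring
    have hcj : c j = 0 := hc j (Or.inl (by simp))
    let ψ : (Fin (n + 1) → ℝ) →L[ℝ] ℝ := ∑ i, c i • a i
    have hψa : ∀ x, ψ x = ∑ i, c i * a i x := fun x => by simp [ψ]
    have hψ : ψ = ψ (e (1, 0)) • a j := by
      refine ContinuousLinearMap.ext fun x => ?_
      obtain ⟨⟨t, y⟩, rfl⟩ := e.surjective x
      have h1 : ∑ i, c i * a' i y = 0 := by
        simpa using congrArg (fun l : (Fin n → ℝ) →L[ℝ] ℝ => l y) hsum
      change ψ (e (t, y)) = ψ (e (1, 0)) * a j (e (t, y))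
      rw [he, hψa, hψa, Finset.sum_mul, ← sub_eq_zero, ← Finset.sum_sub_distrib, ← h1]
      refine Finset.sum_congr rfl fun i _ => ?_
      rw [hsplit i t y]
      ring
    let c' : ι → ℝ := fun i => c i - if i = j then ψ (e (1, 0)) else 0
    have hmem : e (-b j, y) ∈ halfSpaces s a b := by
      intro i hi
      by_cases hij : i = j
      · subst hij; simp [he]
      · rw [hval]; exact hy i (Finset.mem_erase.2 ⟨hij, hi⟩)
    have := hind _ hmem c' (by
      intro i hi
      have hij : i ≠ j := by
        rintro rfl
        rcases hi with hi | hi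
        · exact hi hj
        · simp [he] at hi
      simp only [c', hij, if_false, sub_zero]
      refine hc i ?_
      rw [hval] at hi
      simpa [hij] using hi) (by
      rw [← sub_eq_zero.2 hψ]
      refine ContinuousLinearMap.ext fun x => ?_
      change _ = ψ x - ψ (e (1, 0)) * a j x
      simp [c', sub_mul, hψa])
    intro i
    by_cases hij : i = j
    · rw [hij, hcj]
    · simpa [c', hij] using this i
  have hFe : IsPolyOfDegreeLE d (fun w : Option (Fin n) → ℝ =>
      F (e (w none, fun i => w (some i)))) := by
    refine hF.comp fun k => ?_
    let l : (Option (Fin n) → ℝ) →ₗ[ℝ] ℝ × (Fin n → ℝ) :=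
      (LinearMap.proj none).prod (LinearMap.pi fun i => LinearMap.proj (some i))
    exact IsPolyOfDegreeLE.linear
      ((LinearMap.proj (φ := fun _ => ℝ) k).comp (e.toLinearEquiv.toLinearMap.comp l))
  obtain ⟨S, co, hS, hco⟩ := hFe.exists_monomials
  have hco' : ∀ t y, F (e (t, y)) =
      ∑ m ∈ S, co m * t ^ m none * ∏ i, y i ^ m (some i) := by
    intro t y
    have := hco (fun o => o.elim t y)
    simpa [Fintype.prod_option, mul_assoc] using this
  have hmon : ∀ m : Option (Fin n) →₀ ℕ, IsPolyOfDegreeLE (∑ i, m (some i))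
      (fun y : Fin n → ℝ => ∏ i, y i ^ m (some i)) := fun m =>
    IsPolyOfDegreeLE.prod Finset.univ fun i _ => (IsPolyOfDegreeLE.coord i).pow (m (some i))
  choose G hG hG' using fun m => ih (s.erase j) a' b' ha' hind' _ _ (hmon m)
  let w : (Option ι → ℝ) → ι → ℝ := fun o i => o (some i) + α i * (o none + b j)
  refine ⟨fun o => ∑ m ∈ S, co m * (o none ^ m none * G m (w o)), ?_, ?_⟩
  · refine IsPolyOfDegreeLE.sum _ fun m hm => IsPolyOfDegreeLE.const_mul _ ?_
    have hw : ∀ i, IsPolyOfDegreeLE 1 (fun o : Option ι → ℝ => w o i) := fun i =>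
      (IsPolyOfDegreeLE.coord _).add
        (((IsPolyOfDegreeLE.coord _).add (IsPolyOfDegreeLE.const _)).const_mul _)
    refine (((IsPolyOfDegreeLE.coord none).pow _).mul ((hG m).comp hw)).mono ?_
    have := hS m hm
    rw [Fintype.sum_option] at this
    omega
  · have ht : Filter.Tendsto (fun z : ℝ × (ι → ℝ) => w (fun o => o.elim z.1 z.2))
        (nhds (-b j, 0)) (nhds 0) := by
      have hc : Continuous (fun z : ℝ × (ι → ℝ) => w (fun o => o.elim z.1 z.2)) := by
        simp only [w, Option.elim]; fun_prop
      have h0 : w (fun o => o.elim (-b j) (0 : ι → ℝ)) = 0 := by ext i; simp [w]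
      simpa only [h0] using hc.tendsto (-b j, 0)
    have hall := (Filter.eventually_all_finset S).2 fun m _ => ht.eventually (hG' m)
    filter_upwards [hall] with z hz
    have hset : {y | ∀ i ∈ s.erase j, 0 ≤ a i (e (z.1, y)) + (b + z.2) i} =
        halfSpaces (s.erase j) a' (b' + w (fun o => o.elim z.1 z.2)) := by
      ext y
      simp only [halfSpaces, Set.mem_ofPred_eq, hsplit, Pi.add_apply, b', w, Option.elim]
      refine forall₂_congr fun i _ => ?_
      ring_nf
    rw [hset]
    simp only [hco']
    rw [integral_finsetSum]
    · refine Finset.sum_congr rfl fun m hm => ?_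
      rw [integral_const_mul, hz m hm]
      simp [mul_assoc]
    · intro m _
      exact (Continuous.continuousOn (by fun_prop)).integrableOn_compact
        (isCompact_halfSpaces ha' _)

theorem integral_sub_update {s : Finset ι} {a : ι → (Fin (n + 1) → ℝ) →L[ℝ] ℝ} {b : ι → ℝ}
    (ih : ∀ (s : Finset ι) (a : ι → (Fin n → ℝ) →L[ℝ] ℝ) (b : ι → ℝ),
      (∀ x, (∀ i ∈ s, 0 ≤ a i x) → x = 0) → ActiveIndependent s a b →
      ∀ (d : ℕ) (F : (Fin n → ℝ) → ℝ), IsPolyOfDegreeLE d F →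
      ∃ G : (ι → ℝ) → ℝ, IsPolyOfDegreeLE (d + n) G ∧
        ∀ᶠ h in nhds (0 : ι → ℝ), ∫ x in halfSpaces s a (b + h), F x = G h)
    (ha : ∀ x, (∀ i ∈ s, 0 ≤ a i x) → x = 0) (hind : ActiveIndependent s a b)
    {d : ℕ} {F : (Fin (n + 1) → ℝ) → ℝ} (hF : IsPolyOfDegreeLE d F) {j : ι} (hj : j ∈ s)
    (haj : a j ≠ 0) :
    ∃ G : (ι → ℝ) → ℝ, IsPolyOfDegreeLE (d + (n + 1)) G ∧
      ∀ᶠ h in nhds (0 : ι → ℝ), (∫ x in halfSpaces s a (b + h), F x) -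
        (∫ x in halfSpaces s a (b + Function.update h j 0), F x) = G h := by
  obtain ⟨e, he⟩ := exists_prod_equiv haj
  obtain ⟨c, hc⟩ := exists_integral_comp_equiv e
  obtain ⟨G, hG, hG'⟩ := slice_integral ih ha hind hF hj e he
  let T : (ι → ℝ) → ℝ → ℝ := fun h t =>
    ∫ y in {y | ∀ i ∈ s.erase j, 0 ≤ a i (e (t, y)) + (b + h) i}, F (e (t, y))
  have hV : ∀ h : ι → ℝ, IntegrableOn (T h) (Set.Ici (-b j - h j)) ∧
      ∫ x in halfSpaces s a (b + h), F x = c * ∫ t in Set.Ici (-b j - h j), T h t := by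
    intro h
    have hm := (isClosed_halfSpaces (s := s) (a := a) (b + h)).measurableSet
    let Q : Set (ℝ × (Fin n → ℝ)) := e ⁻¹' halfSpaces s a (b + h)
    have hQm : MeasurableSet Q := e.continuous.measurable hm
    have hQc : IsCompact Q :=
      e.toHomeomorph.isCompact_preimage.2 (isCompact_halfSpaces ha (b + h))
    let g : ℝ × (Fin n → ℝ) → ℝ := Q.indicator fun p => F (e p)
    have hgi : Integrable g ((volume : Measure ℝ).prod (volume : Measure (Fin n → ℝ))) := by
      refine (integrable_indicator_iff hQm).2 ?_
      exact (hF.continuous.comp e.continuous).continuousOn.integrableOn_compact hQc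
    have hT : (fun t => ∫ y, g (t, y)) = (Set.Ici (-b j - h j)).indicator (T h) := by
      ext t
      by_cases ht : t ∈ Set.Ici (-b j - h j)
      · rw [Set.indicator_of_mem ht]
        have hms : MeasurableSet {y | ∀ i ∈ s.erase j, 0 ≤ a i (e (t, y)) + (b + h) i} := by
          refine IsClosed.measurableSet ?_
          simp only [Set.ofPred_forall]
          exact isClosed_biInter fun i _ => isClosed_le continuous_const (by fun_prop)
        simp only [T]
        rw [← integral_indicator hms]
        refine integral_congr_ae (Filter.Eventually.of_forall fun y => ?_)
        have hiff : (t, y) ∈ Q ↔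
            y ∈ {y | ∀ i ∈ s.erase j, 0 ≤ a i (e (t, y)) + (b + h) i} := by
          simp only [Q, halfSpaces, Set.mem_preimage, Set.mem_ofPred_eq, Finset.mem_erase]
          refine ⟨fun H i hi => H i hi.2, fun H i hi => ?_⟩
          by_cases hij : i = j
          · subst hij
            rw [he]
            simp only [Set.mem_Ici] at ht
            simp only [Pi.add_apply]
            linarith
          · exact H i ⟨hij, hi⟩
        change Q.indicator (fun p => F (e p)) (t, y) = _
        by_cases hy : (t, y) ∈ Q
        · rw [Set.indicator_of_mem hy, Set.indicator_of_mem (hiff.1 hy)]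
        · rw [Set.indicator_of_notMem hy, Set.indicator_of_notMem (mt hiff.2 hy)]
      · rw [Set.indicator_of_notMem ht]
        refine integral_eq_zero_of_ae (Filter.Eventually.of_forall fun y => ?_)
        refine Set.indicator_of_notMem (fun H => ht ?_) _
        have := H j hj
        rw [he] at this
        simp only [Pi.add_apply] at this
        simp only [Set.mem_Ici]
        linarith
    constructor
    · have := hgi.integral_prod_left
      rw [hT] at this
      exact (integrable_indicator_iff measurableSet_Ici).1 this
    · rw [← integral_indicator hm, hc, ← integral_indicator measurableSet_Ici, ← hT]
      congr 1
      exact integral_prod g hgi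
  refine ⟨fun h => c * ∫ t in (-b j - h j)..(-b j), G (fun o => o.elim t h), ?_, ?_⟩
  · exact (hG.intervalIntegral ((IsPolyOfDegreeLE.const _).sub (IsPolyOfDegreeLE.coord j))
      (IsPolyOfDegreeLE.const _)).const_mul c
  · obtain ⟨ε, hε, hε'⟩ := Metric.eventually_nhds_iff.1 hG'
    filter_upwards [Metric.ball_mem_nhds (0 : ι → ℝ) hε] with h hh
    have hTu : T (Function.update h j 0) = T h := by
      ext t
      have : {y | ∀ i ∈ s.erase j, 0 ≤ a i (e (t, y)) + (b + Function.update h j 0) i} =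
          {y | ∀ i ∈ s.erase j, 0 ≤ a i (e (t, y)) + (b + h) i} := by
        ext y
        refine forall₂_congr fun i hi => ?_
        simp [Function.update_of_ne (Finset.ne_of_mem_erase hi)]
      simp only [T, this]
    have h1 := hV h
    have h2 := hV (Function.update h j 0)
    rw [hTu, Function.update_self, sub_zero] at h2
    rw [h1.2, h2.2, ← mul_sub, intervalIntegral.integral_Ici_sub_Ici' h1.1 h2.1]
    congr 1
    refine intervalIntegral.integral_congr fun t ht => ?_
    refine hε' (y := (t, h)) ?_
    rw [Prod.dist_eq]
    refine max_lt ?_ (by simpa using hh)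
    rw [mem_ball_zero_iff] at hh
    have hjh := (norm_le_pi_norm h j).trans_lt hh
    refine lt_of_le_of_lt ?_ hjh
    have := Set.abs_sub_right_of_mem_uIcc ht
    rw [Real.dist_eq, abs_sub_comm]
    simpa using this

/-- The integral of a polynomial over a simple polytope is polynomial in small displacements of
the facets. -/
theorem integral_halfSpaces_eq_poly (n : ℕ) : ∀ (s : Finset ι) (a : ι → (Fin n → ℝ) →L[ℝ] ℝ)
    (b : ι → ℝ), (∀ x, (∀ i ∈ s, 0 ≤ a i x) → x = 0) → ActiveIndependent s a b →
      ∀ (d : ℕ) (F : (Fin n → ℝ) → ℝ), IsPolyOfDegreeLE d F →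
      ∃ G : (ι → ℝ) → ℝ, IsPolyOfDegreeLE (d + n) G ∧
        ∀ᶠ h in nhds (0 : ι → ℝ), ∫ x in halfSpaces s a (b + h), F x = G h := by
  induction n with
  | zero =>
    intro s a b ha hind d F hF
    rcases (halfSpaces s a b).eq_empty_or_nonempty with hP | ⟨x, hx⟩
    · refine ⟨_, IsPolyOfDegreeLE.const 0, ?_⟩
      filter_upwards [eventually_halfSpaces_eq_empty ha hP] with h hh
      simp [hh]
    · refine ⟨_, IsPolyOfDegreeLE.const (∫ x, F x), ?_⟩
      have ha0 : ∀ i, a i = 0 := fun i => by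
        ext y; rw [Subsingleton.elim y 0, map_zero, map_zero]
      have hb : ∀ i ∈ s, 0 < b i := by
        intro i hi
        have h0 := hx i hi
        rw [ha0] at h0
        refine (by simpa using h0 : 0 ≤ b i).lt_of_ne fun hbi => ?_
        have := hind x hx (Pi.single i 1) (fun k hk => by
          rw [Pi.single_apply, if_neg]
          rintro rfl
          simp [hi, ha0, ← hbi] at hk) (by simp [ha0]) i
        simp at this
      have : ∀ᶠ h in nhds (0 : ι → ℝ), ∀ i ∈ s, 0 < (b + h) i := by
        refine (Filter.eventually_all_finset s).2 fun i hi => ?_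
        have hc : Continuous fun h : ι → ℝ => (b + h) i := by simp only [Pi.add_apply]; fun_prop
        exact continuousAt_const.eventually_lt hc.continuousAt (by simpa using hb i hi)
      filter_upwards [this] with h hh
      have : halfSpaces s a (b + h) = Set.univ :=
        Set.eq_univ_of_forall fun y i hi => by simpa [ha0] using (hh i hi).le
      rw [this, setIntegral_univ]
  | succ n ih =>
    intro s a b ha hind d F hF
    rcases (halfSpaces s a b).eq_empty_or_nonempty with hP | ⟨x, hx⟩
    · refine ⟨_, IsPolyOfDegreeLE.const 0, ?_⟩
      filter_upwards [eventually_halfSpaces_eq_empty ha hP] with h hh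
      simp [hh]
    have hstep : ∀ j, ∃ G : (ι → ℝ) → ℝ, IsPolyOfDegreeLE (d + (n + 1)) G ∧
        ∀ᶠ h in nhds (0 : ι → ℝ), (∫ x in halfSpaces s a (b + h), F x) -
          (∫ x in halfSpaces s a (b + Function.update h j 0), F x) = G h := by
      intro j
      have htriv (hset : ∀ᶠ h in nhds (0 : ι → ℝ), halfSpaces s a (b + h) =
          halfSpaces s a (b + Function.update h j 0)) : ∃ G : (ι → ℝ) → ℝ,
          IsPolyOfDegreeLE (d + (n + 1)) G ∧
          ∀ᶠ h in nhds (0 : ι → ℝ), (∫ x in halfSpaces s a (b + h), F x) -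
            (∫ x in halfSpaces s a (b + Function.update h j 0), F x) = G h := by
        refine ⟨_, IsPolyOfDegreeLE.const 0, ?_⟩
        filter_upwards [hset] with h hh
        rw [hh, sub_self]
      by_cases hj : j ∈ s
      · by_cases haj : a j = 0
        · have h0 := hx j hj
          have hbj : 0 < b j := by
            rw [haj] at h0
            refine (by simpa using h0 : 0 ≤ b j).lt_of_ne fun hbi => ?_
            have := hind x hx (Pi.single j 1) (fun k hk => by
              rw [Pi.single_apply, if_neg]
              rintro rfl
              simp [hj, haj, ← hbi] at hk) (by simp [Pi.single_apply, haj]) j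
            simp at this
          refine htriv ?_
          have hc : Continuous fun h : ι → ℝ => b j + h j := by fun_prop
          filter_upwards [continuousAt_const.eventually_lt hc.continuousAt
            (by simpa using hbj : (0 : ℝ) < b j + (0 : ι → ℝ) j)] with h hh
          ext y
          refine forall₂_congr fun i hi => ?_
          by_cases hij : i = j
          · subst hij
            simp [haj, hh.le, hbj.le]
          · simp [hij]
        · exact integral_sub_update ih ha hind hF hj haj
      · refine htriv (Filter.Eventually.of_forall fun h => ?_)
        ext y
        refine forall₂_congr fun i hi => ?_
        have hij : i ≠ j := by rintro rfl; exact hj hi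
        simp [hij]
    let R : Finset ι → (ι → ℝ) → ι → ℝ := fun t h i => if i ∈ t then h i else 0
    have hR : ∀ t, Filter.Tendsto (R t) (nhds 0) (nhds 0) := by
      intro t
      have hc : Continuous (R t) := by
        refine continuous_pi fun i => ?_
        by_cases hi : i ∈ t
        · simpa [R, hi] using continuous_apply i
        · simpa [R, hi] using continuous_const
      have h0 : R t 0 = 0 := by ext i; simp [R]
      simpa only [h0] using hc.tendsto 0
    have main : ∀ t : Finset ι, ∃ G : (ι → ℝ) → ℝ, IsPolyOfDegreeLE (d + (n + 1)) G ∧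
        ∀ᶠ h in nhds (0 : ι → ℝ), ∫ x in halfSpaces s a (b + R t h), F x = G h := by
      intro t
      induction t using Finset.induction_on with
      | empty =>
        refine ⟨_, IsPolyOfDegreeLE.const (∫ x in halfSpaces s a b, F x), ?_⟩
        refine Filter.Eventually.of_forall fun h => ?_
        have : R ∅ h = 0 := by ext i; simp [R]
        rw [this, add_zero]
      | insert j t hjt iht =>
        obtain ⟨G₁, hG₁, h₁⟩ := iht
        obtain ⟨G₂, hG₂, h₂⟩ := hstep j
        refine ⟨_, hG₁.add (hG₂.comp (g := R (insert j t)) fun i => ?_), ?_⟩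
        · by_cases hi : i ∈ insert j t
          · simpa only [R, hi, if_true] using IsPolyOfDegreeLE.coord i
          · simpa only [R, hi, if_false] using IsPolyOfDegreeLE.const 0
        · filter_upwards [h₁, (hR (insert j t)).eventually h₂] with h h₁ h₂
          have : Function.update (R (insert j t) h) j 0 = R t h := by
            ext i
            by_cases hij : i = j
            · subst hij; simp [R, hjt]
            · simp [R, hij]
          rw [this, h₁] at h₂
          linarith
    obtain ⟨G, hG, hG'⟩ := main Finset.univ
    refine ⟨G, hG, ?_⟩
    simpa [R] using hG'

end Slices

/-- Let `P = {m : ⟨m,uⱼ⟩ + cⱼ ≥ 0}` be a full-dimensional simple lattice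
polytope with facet presentation given by the primitive inward normals `uⱼ` (the `Fⱼ` being
exactly the facets of `P`).  For every polynomial `f` on `ℝ^n` of degree `d` there exist a
neighborhood `U` of `0 ∈ ℝ^r` and a polynomial `q_f ∈ ℝ[h₁,…,h_r]` of total degree at most
`d + n` such that `∫_{P(h)} f dλ = q_f(h)` for all `h ∈ U`. -/
theorem stmt7 (n r : ℕ) (u : Fin r → Fin n → ℤ) (c : Fin r → ℤ)
    (hlat : ∃ S : Finset (Fin n → ℤ), Pset u c = convexHull ℝ (castZ '' ↑S))
    (hfull : (interior (Pset u c)).Nonempty)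
    (hprim : ∀ j, Finset.univ.gcd (u j) = 1)
    (hfacet : ∀ j, Module.finrank ℝ (affineSpan ℝ (Fface u c j)).direction = n - 1)
    (hinj : Function.Injective (Fface u c))
    (hsimp : ∀ m ∈ Pset u c,
      LinearIndependent ℝ
        (fun j : {j : Fin r // pairR m (u j) + (c j : ℝ) = 0} => castZ (u j.1)))
    (f : MvPolynomial (Fin n) ℝ) (d : ℕ) (hd : f.totalDegree ≤ d) :
    ∃ U ∈ nhds (0 : Fin r → ℝ), ∃ q : MvPolynomial (Fin r) ℝ,
      q.totalDegree ≤ d + n ∧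
      ∀ h ∈ U, ∫ m in Ph u c h, MvPolynomial.eval m f ∂volume = MvPolynomial.eval h q := by
  classical
  let a : Fin r → (Fin n → ℝ) →L[ℝ] ℝ := fun j =>
    ∑ i, (u j i : ℝ) • ContinuousLinearMap.proj (φ := fun _ : Fin n => ℝ) i
  have ha : ∀ j m, a j m = pairR m (u j) := fun j m => by simp [a, pairR, mul_comm]
  let b : Fin r → ℝ := fun j => c j
  have hP : ∀ h, Ph u c h = halfSpaces Finset.univ a (b + h) := fun h => by
    ext m
    simp [Ph, halfSpaces, ha, b, add_assoc]
  have hP0 : Pset u c = halfSpaces Finset.univ a b := by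
    ext m
    simp [Pset, halfSpaces, ha, b]
  have hrec : ∀ x, (∀ i ∈ Finset.univ, 0 ≤ a i x) → x = 0 := by
    intro x hx
    obtain ⟨S, hS⟩ := hlat
    have hbd : Bornology.IsBounded (Pset u c) := by
      rw [hS]
      exact ((S.finite_toSet.image castZ).isCompact_convexHull (𝕜 := ℝ)).isBounded
    obtain ⟨C, hC⟩ := hbd.exists_norm_le
    obtain ⟨x₀, hx₀⟩ := hfull.mono interior_subset
    by_contra hne
    have hn : 0 < ‖x‖ := norm_pos_iff.2 hne
    let t : ℝ := (|C| + ‖x₀‖ + 1) / ‖x‖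
    have ht : 0 ≤ t := by positivity
    have hmem : x₀ + t • x ∈ Pset u c := by
      rw [hP0] at hx₀ ⊢
      intro i hi
      have h1 := hx₀ i hi
      have h2 := mul_nonneg ht (hx i hi)
      rw [map_add, map_smul, smul_eq_mul]
      linarith
    have h1 := hC _ hmem
    have h2 : ‖t • x‖ = |C| + ‖x₀‖ + 1 := by
      rw [norm_smul, Real.norm_of_nonneg ht, div_mul_cancel₀ _ hn.ne']
    have h3 := norm_sub_le (x₀ + t • x) x₀
    rw [add_sub_cancel_left, h2] at h3
    linarith [le_abs_self C]
  have hind : ActiveIndependent Finset.univ a b := by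
    intro m hm k hk hsum
    have hli := Fintype.linearIndependent_iff.1 (hsimp m (hP0 ▸ hm)) (fun j => k j.1) (by
      have hall : ∑ j, k j • castZ (u j) = 0 := by
        ext i
        have := congrArg (fun l : (Fin n → ℝ) →L[ℝ] ℝ => l (Pi.single i 1)) hsum
        simpa [a, castZ, Pi.single_apply] using this
      rw [← hall]
      refine Fintype.sum_of_injective Subtype.val Subtype.val_injective _ _ ?_ fun _ => rfl
      intro j hj
      rw [hk j (Or.inr fun h0 => hj ⟨⟨j, by simpa [ha, b] using h0⟩, rfl⟩), zero_smul])
    intro j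
    by_cases hj : pairR m (u j) + (c j : ℝ) = 0
    · exact hli ⟨j, hj⟩
    · exact hk j (Or.inr (by simpa [ha, b] using hj))
  obtain ⟨G, ⟨q, hq, hGq⟩, hG⟩ := integral_halfSpaces_eq_poly n Finset.univ a b hrec hind d
    (fun m => MvPolynomial.eval m f) ⟨f, hd, fun _ => rfl⟩
  refine ⟨_, hG, q, hq, fun h hh => ?_⟩
  rw [hP, ← hGq]
  exact hh
end
end

section
/- For every polynomial function $f$ on $\mathbb{R}^n$ of degree $d$ there is a polynomial $E_{P,f}$ in one variable of degree at most $n + d$ such that $E_{P,f}(k) = \sum_{m \in kP \cap \mathbb{Z}^n} f(m)$ for every positive integer $k$, and its value at $0$ is $E_{P,f}(0) = f(0)$ (the weighted Ehrhart polynomial of $P$ with weight $f$ has constant term $f(0)$). -/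
open MeasureTheory Pointwise

noncomputable section

open scoped Classical in
/-- If a linear combination of indicator functions of compact intervals vanishes, so does the sum
of the coefficients of the nonempty intervals. -/
theorem sum_coeff_nonempty_eq_zero_real {ι : Type*} [Fintype ι] (K : ι → Set ℝ) (c : ι → ℤ)
    (hK : ∀ i, IsCompact (K i)) (hconv : ∀ i, Convex ℝ (K i))
    (h : ∀ t, ∑ i, (if t ∈ K i then c i else 0) = 0) :
    ∑ i, (if (K i).Nonempty then c i else 0) = 0 := by
  have key : ∀ t, ∑ i, (if (K i).Nonempty ∧ sSup (K i) = t then c i else 0) = 0 := by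
    intro t
    have hev : ∀ᶠ s in nhdsWithin t (Set.Ioi t),
        ∀ i, (s ∈ K i ↔ t ∈ K i ∧ sSup (K i) ≠ t) := by
      rw [Filter.eventually_all]
      intro i
      by_cases ht : t ∈ K i
      · have hle : t ≤ sSup (K i) := le_csSup (hK i).bddAbove ht
        rcases hle.eq_or_lt with he | hlt
        · filter_upwards [self_mem_nhdsWithin] with s hs
          simp only [ht, ← he, ne_eq, not_true_eq_false, and_false, iff_false]
          intro hsK
          have := le_csSup (hK i).bddAbove hsK
          simp only [Set.mem_Ioi] at hs
          linarith
        · filter_upwards [Ioo_mem_nhdsGT hlt] with s hs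
          simp only [ht, ne_eq, hlt.ne', not_false_eq_true, and_self, iff_true]
          exact (hconv i).ordConnected.out ht ((hK i).sSup_mem ⟨t, ht⟩) ⟨hs.1.le, hs.2.le⟩
      · have : (K i)ᶜ ∈ nhds t := (hK i).isClosed.isOpen_compl.mem_nhds ht
        filter_upwards [mem_nhdsWithin_of_mem_nhds this] with s hs
        simp only [ht, false_and, iff_false]
        exact hs
    obtain ⟨s, hs⟩ := hev.exists
    have h1 := h t
    have h2 := h s
    rw [← sub_eq_zero.2 (h1.trans h2.symm), ← Finset.sum_sub_distrib]
    refine Finset.sum_congr rfl fun i _ => ?_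
    have hmem : (K i).Nonempty → sSup (K i) = t → t ∈ K i :=
      fun hne he => he ▸ (hK i).sSup_mem hne
    have hne : t ∈ K i → (K i).Nonempty := fun ht => ⟨t, ht⟩
    have := hs i
    by_cases a : t ∈ K i <;> by_cases b : sSup (K i) = t <;> by_cases d : (K i).Nonempty <;>
      simp_all
  have hsum : ∑ t ∈ Finset.univ.image (fun i => sSup (K i)),
      ∑ i, (if (K i).Nonempty ∧ sSup (K i) = t then c i else 0) = 0 :=
    Finset.sum_eq_zero fun t _ => key t
  rw [Finset.sum_comm] at hsum
  refine (Finset.sum_congr rfl fun i _ => ?_).trans hsum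
  by_cases d : (K i).Nonempty <;> simp [d]

open scoped Classical in
/-- The Euler characteristic of compact convex sets is additive: if a linear combination of
indicator functions of compact convex sets vanishes, so does the sum of the coefficients of the
nonempty sets. -/
theorem sum_coeff_nonempty_eq_zero {ι : Type*} [Fintype ι] (c : ι → ℤ) :
    ∀ (N : ℕ) (K : ι → Set (Fin N → ℝ)), (∀ i, IsCompact (K i)) → (∀ i, Convex ℝ (K i)) →
    (∀ t, ∑ i, (if t ∈ K i then c i else 0) = 0) →
    ∑ i, (if (K i).Nonempty then c i else 0) = 0
  | 0, K, _, _, h => by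
    refine (Finset.sum_congr rfl fun i _ => ?_).trans (h default)
    have : (K i).Nonempty ↔ default ∈ K i :=
      ⟨fun ⟨x, hx⟩ => Subsingleton.elim x default ▸ hx, fun hx => ⟨_, hx⟩⟩
    simp only [this]
  | N + 1, K, hK, hconv, h => by
    have hslice := sum_coeff_nonempty_eq_zero_real (fun i => (fun x => x 0) '' K i) c
      (fun i => (hK i).image (continuous_apply 0))
      (fun i => (hconv i).linear_image (LinearMap.proj 0)) (by
        intro t
        have := sum_coeff_nonempty_eq_zero c N
          (fun i => {q | (Fin.cons t q : Fin (N + 1) → ℝ) ∈ K i})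
          (fun i => by
            have : {q : Fin N → ℝ | (Fin.cons t q : Fin (N + 1) → ℝ) ∈ K i} =
                Fin.tail '' (K i ∩ {x | x 0 = t}) := by
              ext q
              constructor
              · intro hq
                exact ⟨_, ⟨hq, by simp⟩, by simp⟩
              · rintro ⟨x, ⟨hx, hx0⟩, rfl⟩
                have hx0 : x 0 = t := hx0
                subst hx0
                simpa [Fin.cons_self_tail] using hx
            rw [this]
            refine ((hK i).inter_right
              (isClosed_eq (continuous_apply 0) continuous_const)).image ?_
            exact continuous_pi fun j => continuous_apply _)
          (fun i => by
            intro x hx y hy a b ha hb hab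
            have := hconv i hx hy ha hb hab
            have he : a • (Fin.cons t x : Fin (N + 1) → ℝ) + b • (Fin.cons t y : Fin (N + 1) → ℝ)
                = Fin.cons t (a • x + b • y) := by
              ext j
              refine Fin.cases ?_ (fun j => ?_) j
              · simp [← add_mul, hab]
              · simp
            rw [he] at this
            exact this)
          (fun q => h (Fin.cons t q))
        refine (Finset.sum_congr rfl fun i _ => ?_).trans this
        have : t ∈ (fun x : Fin (N + 1) → ℝ => x 0) '' K i ↔
            ({q | (Fin.cons t q : Fin (N + 1) → ℝ) ∈ K i} : Set (Fin N → ℝ)).Nonempty := by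
          constructor
          · rintro ⟨x, hx, rfl⟩
            exact ⟨Fin.tail x, by simpa [Fin.cons_self_tail] using hx⟩
          · rintro ⟨q, hq⟩
            exact ⟨_, hq, by simp⟩
        simp only [this])
    simpa only [Set.image_nonempty] using hslice

/-- A real polynomial has a polynomial indefinite sum. -/
theorem Polynomial.exists_eval_add_one_sub_eval (p : Polynomial ℝ) :
    ∃ q : Polynomial ℝ, ∀ x, q.eval (x + 1) - q.eval x = p.eval x := by
  induction p using Polynomial.induction_on' with
  | add p q hp hq =>
    obtain ⟨p', hp⟩ := hp
    obtain ⟨q', hq⟩ := hq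
    refine ⟨p' + q', fun x => ?_⟩
    rw [Polynomial.eval_add, Polynomial.eval_add, Polynomial.eval_add, ← hp, ← hq]
    ring
  | monomial m a =>
    let B : Polynomial ℝ := (Polynomial.bernoulli (m + 1)).map (algebraMap ℚ ℝ)
    have hB : ∀ x : ℝ, B.eval (x + 1) - B.eval x = (m + 1) * x ^ m := by
      intro x
      have h := congrArg (fun P => Polynomial.eval x (Polynomial.map (algebraMap ℚ ℝ) P))
        (Polynomial.bernoulli_comp_one_add_X (m + 1))
      simp only [Polynomial.map_comp, Polynomial.eval_comp, Polynomial.map_add,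
        Polynomial.eval_add, Polynomial.map_one, Polynomial.map_X, Polynomial.eval_X,
        Polynomial.eval_one] at h
      simp only [B]
      rw [add_comm x 1, h]
      simp
    refine ⟨Polynomial.C (a / (m + 1)) * B, fun x => ?_⟩
    rw [Polynomial.eval_mul, Polynomial.eval_mul, Polynomial.eval_C, Polynomial.eval_C, ← mul_sub,
      hB]
    have : (m : ℝ) + 1 ≠ 0 := by positivity
    simp
    field_simp

/-- A sequence whose iterated difference is polynomial is polynomial. -/
theorem exists_polynomial_of_fwdDiff_iter (r : ℕ) : ∀ (h : ℕ → ℝ) (p : Polynomial ℝ),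
    (∀ k : ℕ, (fwdDiff 1)^[r] h k = p.eval (k : ℝ)) →
    ∃ q : Polynomial ℝ, ∀ k : ℕ, h k = q.eval (k : ℝ) := by
  induction r with
  | zero => exact fun h p hp => ⟨p, hp⟩
  | succ r ih =>
    intro h p hp
    obtain ⟨q, hq⟩ := ih (fwdDiff 1 h) p hp
    obtain ⟨s, hs⟩ := q.exists_eval_add_one_sub_eval
    refine ⟨s + Polynomial.C (h 0 - s.eval 0), fun k => ?_⟩
    induction k with
    | zero => simp
    | succ k ihk =>
      have h1 := hq k
      have h2 := hs k
      simp only [fwdDiff, Polynomial.eval_add, Polynomial.eval_C] at h1 ihk ⊢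
      push_cast
      linarith

/-- Polynomiality of a function on `ℤ^n`, in terms of iterated differences. -/
def HasDiffOrder {n : ℕ} : ℕ → ((Fin n → ℤ) → ℝ) → Prop
  | 0, g => g = 0
  | d + 1, g => ∀ c, HasDiffOrder d fun x => g (x + c) - g x

namespace HasDiffOrder

variable {n : ℕ}

theorem zero : ∀ d, HasDiffOrder (n := n) d fun _ => 0
  | 0 => rfl
  | d + 1 => fun c => by simpa using zero d

theorem add : ∀ {d} {g h : (Fin n → ℤ) → ℝ}, HasDiffOrder d g → HasDiffOrder d h →
    HasDiffOrder d fun x => g x + h x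
  | 0, g, h, hg, hh => by
    have hg : g = 0 := hg
    have hh : h = 0 := hh
    subst hg hh
    exact funext fun x => by simp
  | d + 1, g, h, hg, hh => fun c => by
    simpa only [add_sub_add_comm] using (hg c).add (hh c)

theorem const_mul (a : ℝ) : ∀ {d} {g : (Fin n → ℤ) → ℝ}, HasDiffOrder d g →
    HasDiffOrder d fun x => a * g x
  | 0, g, hg => by
    have hg : g = 0 := hg
    subst hg
    exact funext fun x => by simp
  | d + 1, g, hg => fun c => by
    simpa only [mul_sub] using (hg c).const_mul a

theorem shift (b : Fin n → ℤ) : ∀ {d} {g : (Fin n → ℤ) → ℝ}, HasDiffOrder d g →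
    HasDiffOrder d fun x => g (x + b)
  | 0, g, hg => by
    have hg : g = 0 := hg
    subst hg
    rfl
  | d + 1, g, hg => fun c => by
    simpa only [add_right_comm] using (hg c).shift b

theorem succ : ∀ {d} {g : (Fin n → ℤ) → ℝ}, HasDiffOrder d g → HasDiffOrder (d + 1) g
  | 0, g, hg => by
    have hg : g = 0 := hg
    subst hg
    exact zero 1
  | d + 1, g, hg => fun c => (hg c).succ

theorem mono {d e : ℕ} (hde : d ≤ e) {g : (Fin n → ℤ) → ℝ} (hg : HasDiffOrder d g) :
    HasDiffOrder e g := by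
  induction hde with
  | refl => exact hg
  | step _ ih => exact ih.succ

theorem coord_mul (i : Fin n) : ∀ {d} {g : (Fin n → ℤ) → ℝ}, HasDiffOrder d g →
    HasDiffOrder (d + 1) fun x => (x i : ℝ) * g x
  | 0, g, hg => by
    have hg : g = 0 := hg
    subst hg
    simpa using zero 1
  | d + 1, g, hg => fun c => by
    have h := ((hg c).coord_mul i).add ((hg.shift c).const_mul (c i : ℝ))
    convert h using 2 with x
    push_cast [Pi.add_apply]
    ring

theorem const (a : ℝ) : HasDiffOrder (n := n) 1 fun _ => a := fun _ => by simpa using zero 0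

theorem exists_mvPolynomial (f : MvPolynomial (Fin n) ℝ) :
    ∃ d, HasDiffOrder d fun x => MvPolynomial.eval (castZ x) f := by
  induction f using MvPolynomial.induction_on with
  | C a => exact ⟨1, by simpa using const a⟩
  | add p q hp hq =>
    obtain ⟨d, hd⟩ := hp
    obtain ⟨e, he⟩ := hq
    exact ⟨max d e, by
      simpa using (hd.mono (le_max_left d e)).add (he.mono (le_max_right d e))⟩
  | mul_X p i hp =>
    obtain ⟨d, hd⟩ := hp
    exact ⟨d + 1, by simpa [castZ, mul_comm] using hd.coord_mul i⟩

end HasDiffOrder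

/-- The lattice point `x` lies in the `k`-fold dilatation of the convex hull of the points
`v i`. -/
def InDilate {n r : ℕ} (v : Fin r → Fin n → ℤ) (k : ℕ) (x : Fin n → ℤ) : Prop :=
  ∃ a : Fin r → ℝ, (∀ i, 0 ≤ a i) ∧ ∑ i, a i = k ∧ ∀ j, ∑ i, a i * (v i j : ℝ) = x j

open scoped Classical in
/-- The sum of `g` over the lattice points in the `k`-fold dilatation of the convex hull of the
points `v i`. -/
def dilateSum {n r : ℕ} (v : Fin r → Fin n → ℤ) (g : (Fin n → ℤ) → ℝ) (k : ℕ) : ℝ :=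
  ∑ᶠ x, if InDilate v k x then g x else 0

section Dilate

variable {n r : ℕ} {v : Fin r → Fin n → ℤ}

theorem InDilate.abs_le {M : ℕ} (hM : ∀ i j, |v i j| ≤ M) {k : ℕ} {x : Fin n → ℤ}
    (hx : InDilate v k x) (j : Fin n) : |x j| ≤ k * M := by
  obtain ⟨a, ha, hk, hv⟩ := hx
  have : |(x j : ℝ)| ≤ k * M := by
    rw [← hv j, ← hk, Finset.sum_mul]
    refine (Finset.abs_sum_le_sum_abs _ _).trans (Finset.sum_le_sum fun i _ => ?_)
    rw [abs_mul, abs_of_nonneg (ha i)]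
    exact mul_le_mul_of_nonneg_left (by exact_mod_cast hM i j) (ha i)
  exact_mod_cast this

theorem exists_abs_le (v : Fin r → Fin n → ℤ) : ∃ M : ℕ, 0 < M ∧ ∀ i j, |v i j| ≤ M := by
  refine ⟨1 + ∑ i, ∑ j, (v i j).natAbs, by omega, fun i j => ?_⟩
  have h1 : (v i j).natAbs ≤ ∑ j, (v i j).natAbs :=
    Finset.single_le_sum (f := fun j => (v i j).natAbs) (fun _ _ => Nat.zero_le _)
      (Finset.mem_univ j)
  have h2 : ∑ j, (v i j).natAbs ≤ ∑ i, ∑ j, (v i j).natAbs :=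
    Finset.single_le_sum (f := fun i => ∑ j, (v i j).natAbs) (fun _ _ => Nat.zero_le _)
      (Finset.mem_univ i)
  rw [Int.abs_eq_natAbs]
  exact_mod_cast h1.trans (h2.trans (Nat.le_add_left _ _))

theorem InDilate.mem_Icc {M : ℕ} (hM : ∀ i j, |v i j| ≤ M) {k : ℕ} {x : Fin n → ℤ}
    (hx : InDilate v k x) :
    x ∈ Finset.Icc (fun _ => -(k * M : ℤ)) (fun _ : Fin n => (k * M : ℤ)) :=
  Finset.mem_Icc.2 ⟨fun j => (_root_.abs_le.1 (hx.abs_le hM j)).1,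
    fun j => (_root_.abs_le.1 (hx.abs_le hM j)).2⟩

open scoped Classical in
theorem dilateSum_eq_sum {M : ℕ} (hM : ∀ i j, |v i j| ≤ M) (g : (Fin n → ℤ) → ℝ) (k : ℕ) :
    dilateSum v g k =
      ∑ x ∈ Finset.Icc (fun _ => -(k * M : ℤ)) (fun _ : Fin n => (k * M : ℤ)),
        if InDilate v k x then g x else 0 := by
  refine finsum_eq_sum_of_support_subset _ fun x hx => ?_
  by_cases h : InDilate v k x
  · exact h.mem_Icc hM
  · simp [h] at hx

open scoped Classical in
theorem hasFiniteSupport_dilate (v : Fin r → Fin n → ℤ) (g : (Fin n → ℤ) → ℝ) (k : ℕ) :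
    (Function.support fun x => if InDilate v k x then g x else 0).Finite := by
  obtain ⟨M, -, hM⟩ := exists_abs_le v
  refine (Finset.Icc (fun _ => -(k * M : ℤ)) (fun _ : Fin n => (k * M : ℤ))).finite_toSet.subset
    fun x hx => ?_
  by_cases h : InDilate v k x
  · exact h.mem_Icc hM
  · simp [h] at hx

theorem dilateSum_add (g h : (Fin n → ℤ) → ℝ) (k : ℕ) :
    dilateSum v (fun x => g x + h x) k = dilateSum v g k + dilateSum v h k := by
  classical
  obtain ⟨M, -, hM⟩ := exists_abs_le v
  simp only [dilateSum_eq_sum hM, ← Finset.sum_add_distrib]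
  refine Finset.sum_congr rfl fun x _ => ?_
  split_ifs <;> simp

open scoped Classical in
/-- Inclusion-exclusion over the subpolytopes of the polytope of barycentric coordinates of `x`
where the coordinates in `J` are at least one. -/
theorem sum_neg_one_pow_inDilate (hr : 0 < r) (k : ℕ) (x : Fin n → ℤ) :
    ∑ J : Finset (Fin r),
      (if InDilate v (k + r - J.card) (x - ∑ i ∈ J, v i) then (-1 : ℤ) ^ J.card else 0) = 0 := by
  let K : Finset (Fin r) → Set (Fin r → ℝ) := fun J =>
    {a | (∀ i, 0 ≤ a i) ∧ ∑ i, a i = (k + r : ℕ) ∧ (∀ j, ∑ i, a i * (v i j : ℝ) = x j) ∧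
      ∀ i ∈ J, 1 ≤ a i}
  have hcl : ∀ J, IsClosed (K J) := fun J => by
    simp only [K, Set.ofPred_and, Set.ofPred_forall]
    refine (isClosed_iInter fun i => isClosed_le continuous_const (continuous_apply i)).inter
      ((isClosed_eq (by fun_prop) continuous_const).inter
      ((isClosed_iInter fun j => isClosed_eq (by fun_prop) continuous_const).inter
      (isClosed_iInter fun i => isClosed_iInter fun _ =>
        isClosed_le continuous_const (continuous_apply i))))
  have hcpt : ∀ J, IsCompact (K J) := fun J => by
    refine (isCompact_Icc (a := (0 : Fin r → ℝ))
      (b := fun _ => ((k + r : ℕ) : ℝ))).of_isClosed_subset (hcl J) fun a ha => ⟨ha.1, fun i => ?_⟩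
    rw [← ha.2.1]
    exact Finset.single_le_sum (fun i _ => ha.1 i) (Finset.mem_univ i)
  have hconv : ∀ J, Convex ℝ (K J) := by
    rintro J a ⟨ha0, ha1, ha2, ha3⟩ b ⟨hb0, hb1, hb2, hb3⟩ s t hs ht hst
    refine ⟨fun i => ?_, ?_, fun j => ?_, fun i hi => ?_⟩
    · have := ha0 i
      have := hb0 i
      simp only [Pi.add_apply, Pi.smul_apply, smul_eq_mul]
      positivity
    · simp only [Pi.add_apply, Pi.smul_apply, smul_eq_mul, Finset.sum_add_distrib,
        ← Finset.mul_sum, ha1, hb1]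
      rw [← add_mul, hst, one_mul]
    · simp only [Pi.add_apply, Pi.smul_apply, smul_eq_mul, add_mul, mul_assoc,
        Finset.sum_add_distrib, ← Finset.mul_sum, ha2, hb2]
      rw [← add_mul, hst, one_mul]
    · have := ha3 i hi
      have := hb3 i hi
      simp only [Pi.add_apply, Pi.smul_apply, smul_eq_mul]
      nlinarith
  have hmain := sum_coeff_nonempty_eq_zero (fun J : Finset (Fin r) => (-1 : ℤ) ^ J.card) r K
    hcpt hconv (by
      intro a
      by_cases ha : a ∈ K ∅
      · have hmem : ∀ J, a ∈ K J ↔ J ∈ (Finset.univ.filter fun i => 1 ≤ a i).powerset := by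
          intro J
          rw [Finset.mem_powerset]
          exact ⟨fun h i hi => by simpa using h.2.2.2 i hi,
            fun h => ⟨ha.1, ha.2.1, ha.2.2.1, fun i hi => by simpa using h hi⟩⟩
        simp only [hmem]
        rw [Finset.sum_ite_mem, Finset.univ_inter]
        apply Finset.sum_powerset_neg_one_pow_card_of_nonempty
        by_contra hne
        rw [Finset.not_nonempty_iff_eq_empty, Finset.filter_eq_empty_iff] at hne
        have hlt : ∑ i, a i < ∑ _i : Fin r, (1 : ℝ) :=
          Finset.sum_lt_sum_of_nonempty ⟨⟨0, hr⟩, Finset.mem_univ _⟩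
            fun i hi => not_le.1 (hne hi)
        rw [ha.2.1] at hlt
        simp at hlt
        have : (0 : ℝ) ≤ k := Nat.cast_nonneg k
        linarith
      · refine Finset.sum_eq_zero fun J _ => if_neg fun h => ha ?_
        exact ⟨h.1, h.2.1, h.2.2.1, by simp⟩)
  refine (Finset.sum_congr rfl fun J _ => ?_).trans hmain
  have hJ : J.card ≤ k + r := by
    have := J.card_le_univ
    simp at this
    omega
  have : InDilate v (k + r - J.card) (x - ∑ i ∈ J, v i) ↔ (K J).Nonempty := by
    constructor
    · rintro ⟨a, ha0, ha1, ha2⟩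
      refine ⟨fun i => a i + if i ∈ J then 1 else 0, fun i => ?_, ?_, fun j => ?_, fun i hi => ?_⟩
      · have := ha0 i
        positivity
      · rw [Finset.sum_add_distrib, ha1]
        simp [Nat.cast_sub hJ]
      · simp only [add_mul, Finset.sum_add_distrib, ha2]
        simp
      · simpa [hi] using ha0 i
    · rintro ⟨a, ha0, ha1, ha2, ha3⟩
      refine ⟨fun i => a i - if i ∈ J then 1 else 0, fun i => ?_, ?_, fun j => ?_⟩
      · by_cases hi : i ∈ J
        · simpa [hi] using ha3 i hi
        · simpa [hi] using ha0 i
      · rw [Finset.sum_sub_distrib, ha1]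
        simp [Nat.cast_sub hJ]
      · simp only [sub_mul, Finset.sum_sub_distrib, ha2]
        simp
  simp only [this]

theorem sum_neg_one_pow_dilateSum (hr : 0 < r) (g : (Fin n → ℤ) → ℝ) (k : ℕ) :
    ∑ J : Finset (Fin r),
      (-1 : ℝ) ^ J.card * dilateSum v (fun x => g (x + ∑ i ∈ J, v i)) (k + r - J.card) = 0 := by
  classical
  have hshift : ∀ J : Finset (Fin r),
      (-1 : ℝ) ^ J.card * dilateSum v (fun x => g (x + ∑ i ∈ J, v i)) (k + r - J.card) =
      ∑ᶠ x, (-1 : ℝ) ^ J.card *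
        if InDilate v (k + r - J.card) (x - ∑ i ∈ J, v i) then g x else 0 := by
    intro J
    rw [dilateSum, mul_finsum,
      ← finsum_comp_equiv (Equiv.subRight (∑ i ∈ J, v i))]
    simp
  simp only [hshift]
  rw [sum_finsum_comm]
  · refine (finsum_congr fun x => ?_).trans finsum_zero
    have := congrArg (fun z : ℤ => (z : ℝ) * g x) (sum_neg_one_pow_inDilate (v := v) hr k x)
    simp only [Int.cast_sum, Finset.sum_mul, Int.cast_zero, zero_mul] at this
    refine (Finset.sum_congr rfl fun J _ => ?_).trans this
    split_ifs <;> simp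
  · intro J _
    have hfin := hasFiniteSupport_dilate v (fun x => g (x + ∑ i ∈ J, v i)) (k + r - J.card)
    refine (hfin.preimage (Equiv.subRight (∑ i ∈ J, v i)).injective.injOn).subset fun x hx => ?_
    simp only [Function.mem_support, Set.mem_preimage, ne_eq] at hx ⊢
    contrapose! hx
    simpa using hx

/-- The weighted Ehrhart function is polynomial. -/
theorem exists_polynomial_dilateSum (hr : 0 < r) : ∀ (d : ℕ) (g : (Fin n → ℤ) → ℝ),
    HasDiffOrder d g → ∃ p : Polynomial ℝ, ∀ k : ℕ, dilateSum v g k = p.eval (k : ℝ)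
  | 0, g, hg => by
    have hg : g = 0 := hg
    subst hg
    exact ⟨0, by simp [dilateSum]⟩
  | d + 1, g, hg => by
    choose p hp using fun J : Finset (Fin r) =>
      exists_polynomial_dilateSum hr d _ (hg (∑ i ∈ J, v i))
    refine exists_polynomial_of_fwdDiff_iter r _
      (-∑ J : Finset (Fin r), Polynomial.C ((-1) ^ J.card) *
        (p J).comp (Polynomial.X + Polynomial.C ((r : ℝ) - J.card))) fun k => ?_
    have h := sum_neg_one_pow_dilateSum (v := v) hr g k
    have hsplit : ∀ J : Finset (Fin r),
        dilateSum v (fun x => g (x + ∑ i ∈ J, v i)) (k + r - J.card) =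
        dilateSum v g (k + r - J.card) + (p J).eval ((k : ℝ) + (r - J.card)) := by
      intro J
      have hJ : J.card ≤ k + r := by
        have := J.card_le_univ
        simp at this
        omega
      have hk : (k : ℝ) + (r - J.card) = ((k + r - J.card : ℕ) : ℝ) := by
        rw [Nat.cast_sub hJ]
        push_cast
        ring
      rw [hk, ← hp J, ← dilateSum_add]
      simp
    simp only [hsplit, mul_add, Finset.sum_add_distrib] at h
    rw [fwdDiff_iter_eq_sum_shift]
    have hpow := Finset.sum_powerset_apply_card
      (fun j => (-1 : ℝ) ^ j * dilateSum v g (k + r - j)) (x := (Finset.univ : Finset (Fin r)))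
    simp only [Finset.powerset_univ, Finset.card_univ, Fintype.card_fin] at hpow
    rw [hpow] at h
    simp only [Polynomial.eval_neg, Polynomial.eval_finsetSum, Polynomial.eval_mul,
      Polynomial.eval_C, Polynomial.eval_comp, Polynomial.eval_add, Polynomial.eval_X]
    rw [← eq_neg_of_add_eq_zero_left h, ← Finset.sum_range_reflect]
    refine Finset.sum_congr rfl fun j hj => ?_
    have hj : j ≤ r := by simpa [Nat.lt_succ_iff] using hj
    have e1 : r + 1 - 1 - j = r - j := by omega
    have e2 : r - (r - j) = j := by omega
    have e3 : k + (r - j) • 1 = k + r - j := by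
      simp
      omega
    rw [e1, e2, e3, Nat.choose_symm hj]
    simp
    ring

theorem dilateSum_zero (g : (Fin n → ℤ) → ℝ) : dilateSum v g 0 = g 0 := by
  classical
  rw [dilateSum, finsum_eq_single _ 0, if_pos ⟨0, by simp⟩]
  intro x hx
  refine if_neg fun h => hx ?_
  funext j
  obtain ⟨M, -, hM⟩ := exists_abs_le v
  simpa using h.abs_le hM j

theorem abs_dilateSum_le {M : ℕ} (hM : ∀ i j, |v i j| ≤ M) (g : (Fin n → ℤ) → ℝ) (k : ℕ) (B : ℝ)
    (hB : 0 ≤ B) (hg : ∀ x : Fin n → ℤ, (∀ j, |x j| ≤ k * M) → |g x| ≤ B) :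
    |dilateSum v g k| ≤ (2 * (k * M) + 1) ^ n * B := by
  classical
  rw [dilateSum_eq_sum hM]
  have hcard : (Finset.Icc (fun _ => -(k * M : ℤ)) (fun _ : Fin n => (k * M : ℤ))).card =
      (2 * (k * M) + 1) ^ n := by
    rw [Pi.card_Icc]
    simp only [Int.card_Icc, Finset.prod_const, Finset.card_univ, Fintype.card_fin]
    congr 1
    have : (k * M : ℤ) + 1 - -(k * M : ℤ) = ((2 * (k * M) + 1 : ℕ) : ℤ) := by
      push_cast
      ring
    rw [this, Int.toNat_natCast]
  refine (Finset.abs_sum_le_sum_abs _ _).trans ?_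
  refine (Finset.sum_le_card_nsmul _ _ B fun x _ => ?_).trans_eq ?_
  · split_ifs with h
    · exact hg x fun j => h.abs_le hM j
    · simpa using hB
  · rw [hcard]
    simp

end Dilate

theorem MvPolynomial.exists_abs_eval_le {n : ℕ} (f : MvPolynomial (Fin n) ℝ) {d : ℕ}
    (hd : f.totalDegree ≤ d) : ∃ C : ℝ, 0 ≤ C ∧ ∀ (x : Fin n → ℝ) (R : ℝ), 1 ≤ R →
      (∀ j, |x j| ≤ R) → |MvPolynomial.eval x f| ≤ C * R ^ d := by
  refine ⟨∑ m ∈ f.support, |f.coeff m|, Finset.sum_nonneg fun _ _ => abs_nonneg _,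
    fun x R hR hx => ?_⟩
  rw [MvPolynomial.eval_eq, Finset.sum_mul]
  refine (Finset.abs_sum_le_sum_abs _ _).trans (Finset.sum_le_sum fun m hm => ?_)
  rw [abs_mul]
  refine mul_le_mul_of_nonneg_left ?_ (abs_nonneg _)
  rw [Finset.abs_prod]
  calc ∏ i ∈ m.support, |x i ^ m i| ≤ ∏ i ∈ m.support, R ^ m i := by
        refine Finset.prod_le_prod (fun _ _ => abs_nonneg _) fun i _ => ?_
        rw [abs_pow]
        exact pow_le_pow_left₀ (abs_nonneg _) (hx i) _
    _ = R ^ (m.sum fun _ e => e) := by rw [Finset.prod_pow_eq_pow_sum, Finsupp.sum]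
    _ ≤ R ^ d := pow_le_pow_right₀ hR ((MvPolynomial.le_totalDegree hm).trans hd)

theorem Polynomial.natDegree_le_of_abs_eval_le (p : Polynomial ℝ) (C : ℝ) (N : ℕ)
    (h : ∀ k : ℕ, 0 < k → |p.eval (k : ℝ)| ≤ C * (k : ℝ) ^ N) : p.natDegree ≤ N := by
  by_contra! hlt
  have hdeg : (Polynomial.X ^ N : Polynomial ℝ).degree < p.degree := by
    rw [← Polynomial.natDegree_lt_natDegree_iff (pow_ne_zero _ Polynomial.X_ne_zero),
      Polynomial.natDegree_X_pow]
    exact hlt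
  have ht := (p.abs_div_tendsto_atTop_atTop_of_degree_gt _ hdeg
    (pow_ne_zero _ Polynomial.X_ne_zero)).comp tendsto_natCast_atTop_atTop
  obtain ⟨k, hk, hk0⟩ :=
    ((ht.eventually_gt_atTop C).and (Filter.eventually_gt_atTop 0)).exists
  have hk' : (0 : ℝ) < (k : ℝ) ^ N := by positivity
  simp only [Function.comp_apply, Polynomial.eval_pow, Polynomial.eval_X, abs_div,
    abs_of_pos hk'] at hk
  rw [lt_div_iff₀ hk'] at hk
  exact (h k hk0).not_gt hk

theorem convexHull_range_eq_image_stdSimplex {ι E : Type*} [Fintype ι] [AddCommGroup E]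
    [Module ℝ E] (v : ι → E) :
    convexHull ℝ (Set.range v) = Fintype.linearCombination ℝ v '' stdSimplex ℝ ι := by
  classical
  rw [← convexHull_rangle_single_eq_stdSimplex, LinearMap.image_convexHull, ← Set.range_comp]
  congr 2
  funext i
  simp

theorem castZ_mem_smul_convexHull_iff {n r : ℕ} (v : Fin r → Fin n → ℤ) {k : ℕ} (hk : 0 < k)
    (x : Fin n → ℤ) :
    castZ x ∈ (k : ℝ) • convexHull ℝ (Set.range fun i => castZ (v i)) ↔ InDilate v k x := by
  have hk' : (k : ℝ) ≠ 0 := by exact_mod_cast hk.ne'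
  rw [convexHull_range_eq_image_stdSimplex]
  constructor
  · rintro ⟨_, ⟨a, ⟨ha0, ha1⟩, rfl⟩, hx⟩
    refine ⟨fun i => k * a i, fun i => mul_nonneg (Nat.cast_nonneg k) (ha0 i), ?_, fun j => ?_⟩
    · rw [← Finset.mul_sum, ha1, mul_one]
    · have := congrFun hx j
      simp only [Fintype.linearCombination_apply, Pi.smul_apply, Finset.sum_apply, smul_eq_mul,
        castZ] at this
      simpa only [mul_assoc, ← Finset.mul_sum] using this
  · rintro ⟨a, ha0, ha1, ha2⟩
    refine ⟨_, ⟨fun i => (k : ℝ)⁻¹ * a i,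
      ⟨fun i => mul_nonneg (by positivity) (ha0 i), ?_⟩, rfl⟩, ?_⟩
    · rw [← Finset.mul_sum, ha1, inv_mul_cancel₀ hk']
    · funext j
      simp only [Fintype.linearCombination_apply, Pi.smul_apply, Finset.sum_apply, smul_eq_mul,
        castZ]
      simp only [mul_assoc, ← Finset.mul_sum, ha2]
      rw [mul_inv_cancel_left₀ hk']

/-- Let `P ⊂ ℝ^n` be a full-dimensional simple lattice polytope (the convex
hull of the finite lattice set `S`, with nonempty interior, simple in the sense that at every
vertex the tangent cone is a simplicial cone spanned by `n` primitive lattice vectors).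
For every polynomial `f` on `ℝ^n` of degree `d` there is a univariate polynomial `E_{P,f}`
of degree at most `n + d` with `E_{P,f}(k) = ∑_{m ∈ kP ∩ ℤ^n} f(m)` for every positive
integer `k`, and `E_{P,f}(0) = f(0)`. -/
theorem stmt8 (n : ℕ) (S : Finset (Fin n → ℤ))
    (P : Set (Fin n → ℝ)) (hP : P = convexHull ℝ (castZ '' ↑S))
    (hfull : (interior P).Nonempty)
    (hsimple : ∀ v ∈ P.extremePoints ℝ, ∃ w : Fin n → Fin n → ℤ,
      (∀ i, Finset.univ.gcd (w i) = 1) ∧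
      ∃ ε > 0, P ∩ Metric.ball v ε = tanCone v w ∩ Metric.ball v ε)
    (f : MvPolynomial (Fin n) ℝ) (d : ℕ) (hd : f.totalDegree ≤ d) :
    ∃ E : Polynomial ℝ, E.natDegree ≤ n + d ∧
      (∀ k : ℕ, 0 < k →
        Polynomial.eval (k : ℝ) E =
          ∑ᶠ (x : Fin n → ℤ) (_ : castZ x ∈ (k : ℝ) • P), MvPolynomial.eval (castZ x) f) ∧
      Polynomial.eval (0 : ℝ) E = MvPolynomial.eval (0 : Fin n → ℝ) f := by
  classical
  subst hP
  have hS : S.Nonempty := by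
    by_contra h
    rw [Finset.not_nonempty_iff_eq_empty] at h
    simp [h] at hfull
  have hr : 0 < S.card := hS.card_pos
  let v : Fin S.card → Fin n → ℤ := fun i => S.equivFin.symm i
  have hrange : castZ '' (S : Set (Fin n → ℤ)) = Set.range fun i => castZ (v i) := by
    rw [Set.range_comp' castZ v]
    congr 1
    ext x
    constructor
    · exact fun hx => ⟨S.equivFin ⟨x, hx⟩, by simp [v]⟩
    · rintro ⟨i, rfl⟩
      exact (S.equivFin.symm i).2
  obtain ⟨e, he⟩ := HasDiffOrder.exists_mvPolynomial f
  obtain ⟨E, hE⟩ := exists_polynomial_dilateSum (v := v) hr e _ he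
  obtain ⟨M, hM0, hM⟩ := exists_abs_le v
  obtain ⟨C, hC, hfC⟩ := f.exists_abs_eval_le hd
  refine ⟨E, E.natDegree_le_of_abs_eval_le ((3 * M) ^ n * (C * M ^ d)) _ fun k hk => ?_,
    fun k hk => ?_, ?_⟩
  · have hM1 : (1 : ℝ) ≤ M := by exact_mod_cast hM0
    have hk1 : (1 : ℝ) ≤ k := by exact_mod_cast hk
    have hkM : (1 : ℝ) ≤ k * M := one_le_mul_of_one_le_of_one_le hk1 hM1
    rw [← hE]
    refine (abs_dilateSum_le hM _ k (C * (k * M) ^ d) (by positivity) fun x hx => ?_).trans ?_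
    · exact hfC _ _ hkM fun j => by
        have := hx j
        simp only [castZ]
        exact_mod_cast this
    · calc (2 * ((k : ℝ) * M) + 1) ^ n * (C * (k * M) ^ d)
          ≤ (3 * (k * M)) ^ n * (C * (k * M) ^ d) := by
            gcongr
            linarith
        _ = (3 * M) ^ n * (C * M ^ d) * (k : ℝ) ^ (n + d) := by
            rw [pow_add]
            simp only [mul_pow]
            ring
  · rw [← hE, dilateSum, hrange]
    refine finsum_congr fun x => ?_
    rw [finsum_eq_if]
    simp only [castZ_mem_smul_convexHull_iff v hk]
  · have := hE 0
    rw [dilateSum_zero] at this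
    rw [← Nat.cast_zero, ← this]
    congr
    ext
    simp [castZ]
end
end
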